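/- arXiv:math/0006139 — 6 statements merged into one kernel-verified Lean document; each statement's English description precedes it below -/
import Mathlib

section
/- Let X be a simplicial complex on [n] and let Y ⊆ X be a subset with property U. Then the surjection of cochain complexes K^•(Y) → C^•(Y), given by restricting alternating functions to flag tuples, is a quasi-isomorphism: it induces an isomorphism H^k(K^•(Y)) ≅ H^k(C^•(Y)) for every k ≥ 0. -/
open scoped Classical

def IsSimplicialComplex {n : ℕ} (S : Set (Finset (Fin (n+1)))) : Prop :=
  ∅ ∈ S ∧ ∀ f ∈ S, ∀ g ⊆ f, g ∈ S

/-- Property U for `Y ⊆ X`. -/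
def PropertyU {n : ℕ} (S Y : Set (Finset (Fin (n+1)))) : Prop :=
  Y ⊆ S ∧ ∀ f ∈ Y, ∀ g ∈ Y, f ∪ g ∈ S → f ∪ g ∈ Y

/-- The tuples `Y^{(k)} = {(f_0,…,f_k) ∈ Y^{k+1} : f_0 ∪ … ∪ f_k ∈ Y}` indexing the
cochain complex `K^•(Y)`. -/
def TupU {n : ℕ} (Y : Set (Finset (Fin (n+1)))) (k : ℕ) :
    Set (Fin (k+1) → Finset (Fin (n+1))) :=
  {f | (∀ i, f i ∈ Y) ∧ Finset.univ.sup f ∈ Y}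

/-- Flag tuples: pairwise distinct and pairwise comparable entries of `Y`; these index
the simplicial cochain complex `C^•(Y)` of the order complex `Y′`. -/
def TupFlag {n : ℕ} (Y : Set (Finset (Fin (n+1)))) (k : ℕ) :
    Set (Fin (k+1) → Finset (Fin (n+1))) :=
  {f | (∀ i, f i ∈ Y) ∧ Function.Injective f ∧ ∀ i j, f i ⊆ f j ∨ f j ⊆ f i}

/-- A cochain: an alternating function supported on the tuple set `T`
(functions on `T`, extended by zero to all tuples). -/
def IsAlt {n k : ℕ} (T : Set (Fin (k+1) → Finset (Fin (n+1))))
    (lam : (Fin (k+1) → Finset (Fin (n+1))) → ℂ) : Prop :=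
  (∀ f, f ∉ T → lam f = 0) ∧
  ∀ (f : Fin (k+1) → Finset (Fin (n+1))) (σ : Equiv.Perm (Fin (k+1))),
    lam (f ∘ σ) = ((Equiv.Perm.sign σ : ℤ) : ℂ) * lam f

/-- The simplicial codifferential `(dλ)(f_0,…,f_{k+1}) = Σ_v (−1)^v λ(f_0,…,f̂_v,…)`,
truncated to the tuple set `T'` of the target degree. -/
noncomputable def codiff {n k : ℕ} (T' : Set (Fin (k+2) → Finset (Fin (n+1))))
    (lam : (Fin (k+1) → Finset (Fin (n+1))) → ℂ) :
    (Fin (k+2) → Finset (Fin (n+1))) → ℂ :=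
  fun f => if f ∈ T' then
    ∑ v : Fin (k+2), (-1 : ℂ) ^ (v : ℕ) * lam (v.removeNth f) else 0

/-- Truncation (restriction followed by extension by zero) to a tuple set `T`. -/
noncomputable def truncTo {n k : ℕ} (T : Set (Fin (k+1) → Finset (Fin (n+1))))
    (lam : (Fin (k+1) → Finset (Fin (n+1))) → ℂ) :
    (Fin (k+1) → Finset (Fin (n+1))) → ℂ :=
  fun f => if f ∈ T then lam f else 0

namespace TupleCochain

open Finset

section Coboundary

variable {α : Type*}

/-- The untruncated codifferential on functions of all tuples. -/
noncomputable def d {k : ℕ} (μ : (Fin (k + 1) → α) → ℂ) : (Fin (k + 2) → α) → ℂ :=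
  fun f => ∑ v : Fin (k + 2), (-1 : ℂ) ^ (v : ℕ) * μ (v.removeNth f)

/-- Contraction with the vertex `m`, dual to the cone with apex `m`. -/
def contract {k : ℕ} (m : α) (μ : (Fin (k + 1) → α) → ℂ) : (Fin k → α) → ℂ :=
  fun f => μ (Fin.cons m f)

theorem contract_sub {k : ℕ} (m : α) (μ ν : (Fin (k + 1) → α) → ℂ) :
    contract m (μ - ν) = contract m μ - contract m ν := rfl

theorem d_sub {k : ℕ} (μ ν : (Fin (k + 1) → α) → ℂ) : d (μ - ν) = d μ - d ν := by
  funext f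
  simp [d, mul_sub]

theorem d_add {k : ℕ} (μ ν : (Fin (k + 1) → α) → ℂ) : d (μ + ν) = d μ + d ν := by
  funext f
  simp [d, mul_add, Finset.sum_add_distrib]

theorem d_zero {k : ℕ} : d (0 : (Fin (k + 1) → α) → ℂ) = 0 := by
  funext f
  simp [d]

theorem d_apply_congr {k : ℕ} {μ ν : (Fin (k + 1) → α) → ℂ} {f : Fin (k + 2) → α}
    (h : ∀ v : Fin (k + 2), μ (v.removeNth f) = ν (v.removeNth f)) : d μ f = d ν f := by
  simp [d, h]

theorem removeNth_succ_cons {k : ℕ} (m : α) (f : Fin (k + 1) → α) (v : Fin (k + 1)) :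
    v.succ.removeNth (Fin.cons m f : Fin (k + 2) → α) = Fin.cons m (v.removeNth f) := by
  funext i
  refine Fin.cases ?_ (fun j => ?_) i <;> simp [Fin.removeNth]

theorem d_cons {k : ℕ} (μ : (Fin (k + 2) → α) → ℂ) (m : α) (f : Fin (k + 2) → α) :
    d μ (Fin.cons m f) = μ f - d (contract m μ) f := by
  simp only [d]
  rw [Fin.sum_univ_succ]
  simp only [removeNth_succ_cons, Fin.removeNth_zero, Fin.tail_cons, Fin.val_succ, contract,
    pow_succ]
  simp [sub_eq_add_neg]

theorem cons_eq_const (a : α) (g : Fin 0 → α) : (Fin.cons a g : Fin 1 → α) = fun _ => a := by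
  funext i
  rw [Fin.fin_one_eq_zero i]
  rfl

theorem d_cons_one (μ : (Fin 1 → α) → ℂ) (m : α) (f : Fin 1 → α) :
    d μ (Fin.cons m f) = μ f - μ (fun _ => m) := by
  simp only [d]
  rw [Fin.sum_univ_succ]
  simp only [removeNth_succ_cons, Fin.removeNth_zero, Fin.tail_cons]
  simp [sub_eq_add_neg, cons_eq_const]

theorem contract_d {k : ℕ} (μ : (Fin (k + 2) → α) → ℂ) (m : α) :
    contract m (d μ) = μ - d (contract m μ) :=
  funext fun f => d_cons μ m f

theorem contract_d_one (μ : (Fin 1 → α) → ℂ) (m : α) :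
    contract m (d μ) = μ - fun _ => μ (fun _ => m) :=
  funext fun f => d_cons_one μ m f

theorem d_const_one (c : ℂ) : d (fun _ : Fin 1 → α => c) = 0 := by
  funext f
  simp [d, Fin.sum_univ_two]

theorem d_d {k : ℕ} (μ : (Fin (k + 1) → α) → ℂ) : d (d μ) = 0 := by
  induction k with
  | zero =>
    funext f
    rw [← Fin.cons_self_tail f, d_cons, contract_d_one, d_sub, d_const_one]
    simp
  | succ k ih =>
    funext f
    rw [← Fin.cons_self_tail f, d_cons, contract_d, d_sub, ih]
    simp

/-- Alternating functions on all tuples. -/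
def Alternating {k : ℕ} (μ : (Fin k → α) → ℂ) : Prop :=
  ∀ (f : Fin k → α) (σ : Equiv.Perm (Fin k)), μ (f ∘ σ) = ((Equiv.Perm.sign σ : ℤ) : ℂ) * μ f

theorem Alternating.apply_swap {k : ℕ} {μ : (Fin k → α) → ℂ} (h : Alternating μ)
    (f : Fin k → α) {i j : Fin k} (hij : i ≠ j) : μ (f ∘ Equiv.swap i j) = -μ f := by
  rw [h, Equiv.Perm.sign_swap hij]
  simp

theorem Alternating.of_adjacent {k : ℕ} {μ : (Fin (k + 1) → α) → ℂ}
    (h : ∀ (f : Fin (k + 1) → α) (i : Fin k), μ (f ∘ Equiv.swap i.castSucc i.succ) = -μ f) :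
    Alternating μ := by
  intro f σ
  have hσ : σ ∈ Submonoid.closure
      (Set.range fun i : Fin k => Equiv.swap i.castSucc i.succ) := by
    rw [Equiv.Perm.mclosure_swap_castSucc_succ]
    trivial
  induction hσ using Submonoid.closure_induction generalizing f with
  | mem σ hσ =>
    obtain ⟨i, rfl⟩ := hσ
    rw [h, Equiv.Perm.sign_swap (Fin.castSucc_lt_succ).ne]
    simp
  | one => simp
  | mul σ τ _ _ hσ hτ =>
    rw [Equiv.Perm.coe_mul, ← Function.comp_assoc, hτ, hσ, Equiv.Perm.sign_mul]
    push_cast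
    ring

theorem cons_comp_swap_succ {k : ℕ} (m : α) (f : Fin k → α) (i j : Fin k) :
    (Fin.cons m f : Fin (k + 1) → α) ∘ Equiv.swap i.succ j.succ =
      Fin.cons m (f ∘ Equiv.swap i j) := by
  funext l
  refine Fin.cases ?_ (fun l => ?_) l
  · simp [Equiv.swap_apply_of_ne_of_ne (Fin.succ_ne_zero i).symm (Fin.succ_ne_zero j).symm]
  · rw [Function.comp_apply, (Fin.succ_injective k).swap_apply]
    simp

theorem cons_cons_comp_swap {k : ℕ} (a b : α) (f : Fin k → α) :
    (Fin.cons a (Fin.cons b f : Fin (k + 1) → α) : Fin (k + 2) → α) ∘ Equiv.swap 0 1 =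
      Fin.cons b (Fin.cons a f : Fin (k + 1) → α) := by
  funext l
  refine Fin.cases ?_ (fun l => Fin.cases ?_ (fun l => ?_) l) l
  · simp
  · simp
  · have h : Equiv.swap (0 : Fin (k + 2)) 1 l.succ.succ = l.succ.succ :=
      Equiv.swap_apply_of_ne_of_ne (Fin.succ_ne_zero _)
        (fun h => Fin.succ_ne_zero l (Fin.succ_injective _ h))
    simp [h]

theorem Alternating.contract {k : ℕ} {μ : (Fin (k + 2) → α) → ℂ} (h : Alternating μ) (m : α) :
    Alternating (contract m μ) :=
  .of_adjacent fun f i => by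
    simp only [TupleCochain.contract]
    rw [← cons_comp_swap_succ, h.apply_swap]
    exact fun h => (Fin.castSucc_lt_succ (i := i)).ne (Fin.succ_injective _ h)

theorem Alternating.sub {k : ℕ} {μ ν : (Fin k → α) → ℂ} (hμ : Alternating μ)
    (hν : Alternating ν) : Alternating (μ - ν) := fun f σ => by
  simp [hμ f σ, hν f σ, mul_sub]

theorem Alternating.add {k : ℕ} {μ ν : (Fin k → α) → ℂ} (hμ : Alternating μ)
    (hν : Alternating ν) : Alternating (μ + ν) := fun f σ => by
  simp [hμ f σ, hν f σ, mul_add]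

theorem Alternating.d {k : ℕ} {μ : (Fin (k + 1) → α) → ℂ} (h : Alternating μ) :
    Alternating (d μ) := by
  refine .of_adjacent fun f i => ?_
  induction k with
  | zero =>
    rw [Fin.fin_one_eq_zero i, ← Fin.cons_self_tail f, ← Fin.cons_self_tail (Fin.tail f)]
    simp only [Fin.castSucc_zero, Fin.succ_zero_eq_one]
    rw [cons_cons_comp_swap, d_cons_one, d_cons_one]
    simp [cons_eq_const]
  | succ k ih =>
    refine Fin.cases ?_ (fun j => ?_) i
    · rw [← Fin.cons_self_tail f, ← Fin.cons_self_tail (Fin.tail f)]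
      simp only [Fin.castSucc_zero, Fin.succ_zero_eq_one]
      rw [cons_cons_comp_swap, d_cons, d_cons]
      generalize f 0 = a
      generalize Fin.tail f 0 = b
      generalize Fin.tail (Fin.tail f) = g
      cases k with
      | zero =>
        have hab : μ (Fin.cons b fun _ => a) = -μ (Fin.cons a fun _ => b) := by
          rw [← cons_eq_const a Fin.elim0, ← cons_eq_const b Fin.elim0, ← cons_cons_comp_swap, h.apply_swap _ (by decide)]
        rw [d_cons_one, d_cons_one]
        simp only [TupleCochain.contract, hab]
        ring
      | succ k =>
        have hab : TupleCochain.contract a (TupleCochain.contract b μ) =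
            0 - TupleCochain.contract b (TupleCochain.contract a μ) := by
          funext g
          simp only [TupleCochain.contract, Pi.sub_apply, Pi.zero_apply, zero_sub]
          rw [← cons_cons_comp_swap, h.apply_swap _ (by simp)]
        rw [d_cons, d_cons, hab, d_sub, d_zero]
        simp only [TupleCochain.contract, Pi.sub_apply, Pi.zero_apply]
        ring
    · rw [← Fin.cons_self_tail f, ← Fin.succ_castSucc, cons_comp_swap_succ, d_cons, d_cons,
        ih (h.contract _)]
      have hlt : j.castSucc ≠ j.succ := (Fin.castSucc_lt_succ).ne
      rw [h.apply_swap _ hlt]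
      ring

theorem Alternating.eq_zero_of_not_injective {k : ℕ} {μ : (Fin k → α) → ℂ}
    (h : Alternating μ) {f : Fin k → α} (hf : ¬ Function.Injective f) : μ f = 0 := by
  obtain ⟨i, j, hij, hne⟩ := Function.not_injective_iff.mp hf
  have hswap : f ∘ Equiv.swap i j = f := by
    funext l
    rw [Function.comp_apply, Equiv.swap_apply_def]
    split_ifs <;> simp_all
  have := h.apply_swap f hne
  rw [hswap] at this
  exact self_eq_neg.mp this

end Coboundary

section Subdivision

theorem antitone_cons {α : Type*} [Preorder α] {k : ℕ} {m : α} {g : Fin k → α} (hg : Antitone g) (hm : ∀ i, g i ≤ m) :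
    Antitone (Fin.cons m g : Fin (k + 1) → α) := by
  intro i j
  refine Fin.cases ?_ (fun i => ?_) i <;> refine Fin.cases ?_ (fun j => ?_) j
  · simp
  · simpa using hm j
  · simp
  · simpa using @hg i j

variable {α : Type*} [SemilatticeSup α] [OrderBot α]

/-- The dual of the barycentric subdivision operator on tuples, the barycenter of a tuple being
its supremum. -/
noncomputable def sd : (k : ℕ) → ((Fin (k + 1) → α) → ℂ) → (Fin (k + 1) → α) → ℂ
  | 0, μ => μ
  | k + 1, μ => fun f => d (sd k (contract (univ.sup f) μ)) f

/-- The dual of the chain homotopy between the identity and barycentric subdivision. -/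
noncomputable def htpy : (k : ℕ) → ((Fin (k + 2) → α) → ℂ) → (Fin (k + 1) → α) → ℂ
  | 0, _ => 0
  | k + 1, μ => fun f =>
      contract (univ.sup f) μ f - sd (k + 1) (contract (univ.sup f) μ) f -
        d (htpy k (contract (univ.sup f) μ)) f

theorem sd_succ_apply {k : ℕ} (μ : (Fin (k + 2) → α) → ℂ) (f : Fin (k + 2) → α) :
    sd (k + 1) μ f = d (sd k (contract (univ.sup f) μ)) f := rfl

theorem htpy_succ_apply {k : ℕ} (μ : (Fin (k + 3) → α) → ℂ) (f : Fin (k + 2) → α) :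
    htpy (k + 1) μ f =
      contract (univ.sup f) μ f - sd (k + 1) (contract (univ.sup f) μ) f -
        d (htpy k (contract (univ.sup f) μ)) f := rfl

theorem sd_sub {k : ℕ} (μ ν : (Fin (k + 1) → α) → ℂ) : sd k (μ - ν) = sd k μ - sd k ν := by
  induction k with
  | zero => rfl
  | succ k ih =>
    funext f
    simp [sd, contract_sub, ih, d_sub]

theorem htpy_sub {k : ℕ} (μ ν : (Fin (k + 2) → α) → ℂ) :
    htpy k (μ - ν) = htpy k μ - htpy k ν := by
  induction k with
  | zero => simp [htpy]
  | succ k ih =>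
    funext f
    simp only [htpy_succ_apply, contract_sub, ih, sd_sub, d_sub, Pi.sub_apply]
    ring

theorem sd_d {k : ℕ} (μ : (Fin (k + 1) → α) → ℂ) : sd (k + 1) (d μ) = d (sd k μ) := by
  induction k with
  | zero =>
    funext f
    simp [sd, contract_d_one, d_sub, d_const_one]
  | succ k ih =>
    funext f
    rw [sd_succ_apply, contract_d, sd_sub, ih, d_sub, d_d, sub_zero]

theorem d_htpy_add_htpy_d {k : ℕ} (μ : (Fin (k + 2) → α) → ℂ) :
    d (htpy k μ) + htpy (k + 1) (d μ) = μ - sd (k + 1) μ := by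
  induction k with
  | zero =>
    funext f
    simp only [htpy, contract_d, sd_sub, sd_d, d_zero, Pi.add_apply, Pi.sub_apply, Pi.zero_apply]
    simp [sd]
  | succ k ih =>
    funext f
    have h := eq_sub_of_add_eq' (ih (contract (univ.sup f) μ))
    rw [Pi.add_apply, htpy_succ_apply (d μ), contract_d, htpy_sub, h, sd_sub, sd_d]
    simp only [d_sub, d_d, Pi.sub_apply, Pi.zero_apply]
    rw [sd_succ_apply μ]
    ring

theorem univ_sup_comp_perm {k : ℕ} (f : Fin k → α) (σ : Equiv.Perm (Fin k)) :
    univ.sup (f ∘ σ) = univ.sup f := by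
  refine le_antisymm (Finset.sup_le fun i _ => le_sup (f := f) (mem_univ _))
    (Finset.sup_le fun i _ => ?_)
  simpa using le_sup (f := f ∘ σ) (mem_univ (σ.symm i))

theorem Alternating.sd {k : ℕ} {μ : (Fin (k + 1) → α) → ℂ} (h : Alternating μ) :
    Alternating (sd k μ) := by
  induction k with
  | zero => exact h
  | succ k ih =>
    intro f σ
    simp only [TupleCochain.sd, univ_sup_comp_perm]
    exact (ih (h.contract _)).d f σ

theorem Alternating.htpy {k : ℕ} {μ : (Fin (k + 2) → α) → ℂ} (h : Alternating μ) :
    Alternating (htpy k μ) := by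
  induction k with
  | zero => simp [Alternating, TupleCochain.htpy]
  | succ k ih =>
    intro f σ
    simp only [TupleCochain.htpy, univ_sup_comp_perm]
    exact (((h.contract _).sub (h.contract _).sd).sub (ih (h.contract _)).d) f σ

theorem univ_sup_mem {k : ℕ} {W : Set α} (hW : SupClosed W) {f : Fin (k + 1) → α}
    (hf : ∀ i, f i ∈ W) : univ.sup f ∈ W :=
  hW.finsetSup_mem univ_nonempty fun i _ => hf i

theorem sd_eq_zero {k : ℕ} {W : Set α} (hW : SupClosed W) {μ : (Fin (k + 1) → α) → ℂ}
    (hμ : ∀ g : Fin (k + 1) → α, (∀ i, g i ∈ W) → Antitone g → μ g = 0)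
    {f : Fin (k + 1) → α} (hf : ∀ i, f i ∈ W) : sd k μ f = 0 := by
  induction k generalizing W with
  | zero => exact hμ f hf (Subsingleton.antitone (α := Fin 1) f)
  | succ k ih =>
    have hW' : SupClosed (W ∩ Set.Iic (univ.sup f)) :=
      fun a ha b hb => ⟨hW ha.1 hb.1, sup_le ha.2 hb.2⟩
    rw [sd_succ_apply, d_apply_congr (ν := 0), d_zero, Pi.zero_apply]
    intro v
    refine ih hW' (fun g hg hanti => hμ _ (Fin.cases ?_ fun i => ?_) ?_)
      fun i => ⟨hf _, le_sup (f := f) (mem_univ _)⟩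
    · exact antitone_cons hanti fun i => (hg i).2
    · exact univ_sup_mem hW hf
    · exact (hg i).1

theorem htpy_eq_zero {k : ℕ} {W : Set α} (hW : SupClosed W) {μ : (Fin (k + 2) → α) → ℂ}
    (hμ : ∀ g : Fin (k + 2) → α, (∀ i, g i ∈ W) → μ g = 0)
    {f : Fin (k + 1) → α} (hf : ∀ i, f i ∈ W) : htpy k μ f = 0 := by
  induction k with
  | zero => rfl
  | succ k ih =>
    have hc : ∀ g : Fin (k + 2) → α, (∀ i, g i ∈ W) → contract (univ.sup f) μ g = 0 :=
      fun g hg => hμ _ (Fin.cases (univ_sup_mem hW hf) hg)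
    rw [htpy_succ_apply, hc f hf, sd_eq_zero hW (fun g hg _ => hc g hg) hf, d_apply_congr (ν := 0), d_zero]
    · simp
    · exact fun v => ih hc fun i => hf _

end Subdivision

section Tuples

variable {n : ℕ} {S Y : Set (Finset (Fin (n + 1)))}

theorem supClosed_below (hS : IsSimplicialComplex S) (hU : PropertyU S Y)
    {m : Finset (Fin (n + 1))} (hm : m ∈ Y) : SupClosed {g | g ∈ Y ∧ g ⊆ m} :=
  fun a ha b hb =>
    have hab : a ∪ b ⊆ m := Finset.union_subset ha.2 hb.2
    ⟨hU.2 a ha.1 b hb.1 (hS.2 m (hU.1 hm) _ hab), hab⟩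

theorem mem_below_of_mem_tupU {k : ℕ} {f : Fin (k + 1) → Finset (Fin (n + 1))}
    (hf : f ∈ TupU Y k) (i : Fin (k + 1)) : f i ∈ {g | g ∈ Y ∧ g ⊆ univ.sup f} :=
  ⟨hf.1 i, le_sup (f := f) (mem_univ i)⟩

theorem mem_tupU_of_below (hS : IsSimplicialComplex S) (hU : PropertyU S Y)
    {m : Finset (Fin (n + 1))} (hm : m ∈ Y) {k : ℕ} {g : Fin (k + 1) → Finset (Fin (n + 1))}
    (hg : ∀ i, g i ∈ {g | g ∈ Y ∧ g ⊆ m}) : g ∈ TupU Y k :=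
  ⟨fun i => (hg i).1, (univ_sup_mem (supClosed_below hS hU hm) hg).1⟩

theorem removeNth_mem_tupU (hS : IsSimplicialComplex S) (hU : PropertyU S Y) {k : ℕ}
    {f : Fin (k + 2) → Finset (Fin (n + 1))} (hf : f ∈ TupU Y (k + 1)) (v : Fin (k + 2)) :
    v.removeNth f ∈ TupU Y k :=
  mem_tupU_of_below hS hU hf.2 fun _ => mem_below_of_mem_tupU hf _

theorem removeNth_mem_tupFlag {k : ℕ} {f : Fin (k + 2) → Finset (Fin (n + 1))}
    (hf : f ∈ TupFlag Y (k + 1)) (v : Fin (k + 2)) : v.removeNth f ∈ TupFlag Y k :=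
  ⟨fun _ => hf.1 _, hf.2.1.comp Fin.succAbove_right_injective, fun _ _ => hf.2.2 _ _⟩

theorem supClosed_range_of_mem_tupFlag {k : ℕ} {f : Fin (k + 1) → Finset (Fin (n + 1))}
    (hf : f ∈ TupFlag Y k) : SupClosed (Set.range f) := by
  rintro _ ⟨i, rfl⟩ _ ⟨j, rfl⟩
  rcases hf.2.2 i j with h | h
  · exact ⟨j, (sup_eq_right.mpr h).symm⟩
  · exact ⟨i, (sup_eq_left.mpr h).symm⟩

theorem tupFlag_subset_tupU (k : ℕ) : TupFlag Y k ⊆ TupU Y k := by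
  intro f hf
  obtain ⟨i, hi⟩ := univ_sup_mem (supClosed_range_of_mem_tupFlag hf) fun i => Set.mem_range_self i
  exact ⟨hf.1, hi ▸ hf.1 i⟩

theorem comp_perm_mem_tupU {k : ℕ} {f : Fin (k + 1) → Finset (Fin (n + 1))} (hf : f ∈ TupU Y k)
    (σ : Equiv.Perm (Fin (k + 1))) : f ∘ σ ∈ TupU Y k :=
  ⟨fun _ => hf.1 _, (univ_sup_comp_perm f σ).symm ▸ hf.2⟩

theorem comp_perm_mem_tupFlag {k : ℕ} {f : Fin (k + 1) → Finset (Fin (n + 1))}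
    (hf : f ∈ TupFlag Y k) (σ : Equiv.Perm (Fin (k + 1))) : f ∘ σ ∈ TupFlag Y k :=
  ⟨fun _ => hf.1 _, hf.2.1.comp σ.injective, fun _ _ => hf.2.2 _ _⟩

theorem Alternating.isAlt_truncTo {k : ℕ} {T : Set (Fin (k + 1) → Finset (Fin (n + 1)))}
    (hT : ∀ f ∈ T, ∀ σ : Equiv.Perm (Fin (k + 1)), f ∘ σ ∈ T)
    {μ : (Fin (k + 1) → Finset (Fin (n + 1))) → ℂ} (h : Alternating μ) :
    IsAlt T (truncTo T μ) := by
  refine ⟨fun f hf => if_neg hf, fun f σ => ?_⟩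
  have hiff : f ∘ σ ∈ T ↔ f ∈ T :=
    ⟨fun hf => by simpa [Function.comp_assoc] using hT _ hf σ.symm, fun hf => hT f hf σ⟩
  by_cases hf : f ∈ T
  · simp [truncTo, hiff, hf, h f σ]
  · simp [truncTo, hiff, hf]

theorem truncTo_of_mem {k : ℕ} {T : Set (Fin (k + 1) → Finset (Fin (n + 1)))}
    (μ : (Fin (k + 1) → Finset (Fin (n + 1))) → ℂ) {f : Fin (k + 1) → Finset (Fin (n + 1))}
    (hf : f ∈ T) : truncTo T μ f = μ f := if_pos hf

theorem codiff_of_mem {k : ℕ} {T : Set (Fin (k + 2) → Finset (Fin (n + 1)))}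
    (μ : (Fin (k + 1) → Finset (Fin (n + 1))) → ℂ) {f : Fin (k + 2) → Finset (Fin (n + 1))}
    (hf : f ∈ T) : codiff T μ f = d μ f := if_pos hf

theorem d_eq_zero_of_codiff_eq_zero {k : ℕ} {T : Set (Fin (k + 2) → Finset (Fin (n + 1)))}
    {μ : (Fin (k + 1) → Finset (Fin (n + 1))) → ℂ} (h : codiff T μ = 0)
    {f : Fin (k + 2) → Finset (Fin (n + 1))} (hf : f ∈ T) : d μ f = 0 := by
  rw [← codiff_of_mem μ hf, h, Pi.zero_apply]

theorem d_truncTo_tupU (hS : IsSimplicialComplex S) (hU : PropertyU S Y) {k : ℕ}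
    (μ : (Fin (k + 1) → Finset (Fin (n + 1))) → ℂ) {f : Fin (k + 2) → Finset (Fin (n + 1))}
    (hf : f ∈ TupU Y (k + 1)) : d (truncTo (TupU Y k) μ) f = d μ f :=
  d_apply_congr fun v => truncTo_of_mem μ (removeNth_mem_tupU hS hU hf v)

theorem d_truncTo_tupFlag {k : ℕ}
    (μ : (Fin (k + 1) → Finset (Fin (n + 1))) → ℂ) {f : Fin (k + 2) → Finset (Fin (n + 1))}
    (hf : f ∈ TupFlag Y (k + 1)) : d (truncTo (TupFlag Y k) μ) f = d μ f :=
  d_apply_congr fun v => truncTo_of_mem μ (removeNth_mem_tupFlag hf v)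

theorem Alternating.eq_zero_of_chain {k : ℕ} {μ : (Fin (k + 1) → Finset (Fin (n + 1))) → ℂ}
    (h : Alternating μ) (hμ : ∀ f ∈ TupFlag Y k, μ f = 0)
    {g : Fin (k + 1) → Finset (Fin (n + 1))} (hg : ∀ i, g i ∈ Y)
    (hchain : ∀ i j, g i ⊆ g j ∨ g j ⊆ g i) : μ g = 0 := by
  by_cases hinj : Function.Injective g
  · exact hμ g ⟨hg, hinj, hchain⟩
  · exact h.eq_zero_of_not_injective hinj

theorem Alternating.sd_eq_zero_of_flag (hS : IsSimplicialComplex S) (hU : PropertyU S Y) {k : ℕ}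
    {μ : (Fin (k + 1) → Finset (Fin (n + 1))) → ℂ} (h : Alternating μ)
    (hμ : ∀ f ∈ TupFlag Y k, μ f = 0) {f : Fin (k + 1) → Finset (Fin (n + 1))}
    (hf : f ∈ TupU Y k) : TupleCochain.sd k μ f = 0 :=
  sd_eq_zero (supClosed_below hS hU hf.2)
    (fun _ hg hanti => h.eq_zero_of_chain hμ (fun i => (hg i).1)
      fun i j => (le_total i j).symm.imp (fun hij => hanti hij) fun hij => hanti hij)
    (mem_below_of_mem_tupU hf)

theorem htpy_eq_zero_of_tupU (hS : IsSimplicialComplex S) (hU : PropertyU S Y) {k : ℕ}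
    {μ : (Fin (k + 2) → Finset (Fin (n + 1))) → ℂ} (hμ : ∀ f ∈ TupU Y (k + 1), μ f = 0)
    {f : Fin (k + 1) → Finset (Fin (n + 1))} (hf : f ∈ TupU Y k) : htpy k μ f = 0 :=
  htpy_eq_zero (supClosed_below hS hU hf.2) (fun _ hg => hμ _ (mem_tupU_of_below hS hU hf.2 hg))
    (mem_below_of_mem_tupU hf)

theorem Alternating.htpy_eq_zero_of_flag {k : ℕ}
    {μ : (Fin (k + 2) → Finset (Fin (n + 1))) → ℂ} (h : Alternating μ)
    (hμ : ∀ f ∈ TupFlag Y (k + 1), μ f = 0) {f : Fin (k + 1) → Finset (Fin (n + 1))}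
    (hf : f ∈ TupFlag Y k) : TupleCochain.htpy k μ f = 0 := by
  refine htpy_eq_zero (supClosed_range_of_mem_tupFlag hf) (fun g hg => ?_) fun i => Set.mem_range_self i
  choose s hs using hg
  obtain rfl : f ∘ s = g := funext hs
  exact h.eq_zero_of_chain hμ (fun _ => hf.1 _) fun _ _ => hf.2.2 _ _

/-- Subdivision lifts flag cocycles to cocycles on all tuples. -/
theorem codiff_truncTo_sd (hS : IsSimplicialComplex S) (hU : PropertyU S Y) {k : ℕ}
    {μ : (Fin (k + 1) → Finset (Fin (n + 1))) → ℂ} (h : Alternating μ)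
    (hμ : codiff (TupFlag Y (k + 1)) μ = 0) :
    codiff (TupU Y (k + 1)) (truncTo (TupU Y k) (sd k μ)) = 0 := by
  funext f
  by_cases hf : f ∈ TupU Y (k + 1)
  · rw [codiff_of_mem _ hf, d_truncTo_tupU hS hU _ hf, ← sd_d]
    exact h.d.sd_eq_zero_of_flag hS hU (fun g hg => d_eq_zero_of_codiff_eq_zero hμ hg) hf
  · exact if_neg hf

end Tuples

end TupleCochain


/-- for a property-U subset `Y ⊆ X`, the surjection of cochain complexes
`K^•(Y) → C^•(Y)` (restriction of alternating functions to flag tuples) is a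
quasi-isomorphism.  Concretely: it is a map of cochain complexes, and for every
degree `k` it induces an isomorphism `H^k(K^•(Y)) ≅ H^k(C^•(Y))`, expressed by
surjectivity and injectivity on cohomology classes (degree `0` and degree `k+1`
separately, since there are no coboundaries in degree `0`). -/
theorem K_to_C_quasi_iso {n : ℕ} (S Y : Set (Finset (Fin (n+1))))
    (hS : IsSimplicialComplex S) (hU : PropertyU S Y) :
    -- it is a morphism of cochain complexes
    (∀ (k : ℕ) (lam : (Fin (k+1) → Finset (Fin (n+1))) → ℂ), IsAlt (TupU Y k) lam →
      truncTo (TupFlag Y (k+1)) (codiff (TupU Y (k+1)) lam) =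
        codiff (TupFlag Y (k+1)) (truncTo (TupFlag Y k) lam)) ∧
    -- it is surjective in each degree
    (∀ (k : ℕ) (mu : (Fin (k+1) → Finset (Fin (n+1))) → ℂ), IsAlt (TupFlag Y k) mu →
      ∃ lam, IsAlt (TupU Y k) lam ∧ truncTo (TupFlag Y k) lam = mu) ∧
    -- surjectivity on H^0
    (∀ mu : (Fin 1 → Finset (Fin (n+1))) → ℂ, IsAlt (TupFlag Y 0) mu →
      codiff (TupFlag Y 1) mu = 0 →
      ∃ lam, IsAlt (TupU Y 0) lam ∧ codiff (TupU Y 1) lam = 0 ∧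
        truncTo (TupFlag Y 0) lam = mu) ∧
    -- injectivity on H^0
    (∀ lam : (Fin 1 → Finset (Fin (n+1))) → ℂ, IsAlt (TupU Y 0) lam →
      codiff (TupU Y 1) lam = 0 → truncTo (TupFlag Y 0) lam = 0 → lam = 0) ∧
    -- surjectivity on H^{k+1}
    (∀ (k : ℕ) (mu : (Fin (k+2) → Finset (Fin (n+1))) → ℂ),
      IsAlt (TupFlag Y (k+1)) mu → codiff (TupFlag Y (k+2)) mu = 0 →
      ∃ lam nu, IsAlt (TupU Y (k+1)) lam ∧ codiff (TupU Y (k+2)) lam = 0 ∧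
        IsAlt (TupFlag Y k) nu ∧
        truncTo (TupFlag Y (k+1)) lam = mu + codiff (TupFlag Y (k+1)) nu) ∧
    -- injectivity on H^{k+1}
    (∀ (k : ℕ) (lam : (Fin (k+2) → Finset (Fin (n+1))) → ℂ),
      IsAlt (TupU Y (k+1)) lam → codiff (TupU Y (k+2)) lam = 0 →
      (∃ nu, IsAlt (TupFlag Y k) nu ∧
        truncTo (TupFlag Y (k+1)) lam = codiff (TupFlag Y (k+1)) nu) →
      ∃ rho, IsAlt (TupU Y k) rho ∧ lam = codiff (TupU Y (k+1)) rho) := by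
  open TupleCochain in
  refine ⟨fun k lam _ => ?_, fun k mu hmu => ?_, fun mu hmu hd => ?_, fun lam hlam _ h0 => ?_,
    fun k mu hmu hd => ?_, fun k lam hlam hd => ?_⟩
  · funext f
    by_cases hf : f ∈ TupFlag Y (k + 1)
    · rw [truncTo_of_mem _ hf, codiff_of_mem _ (tupFlag_subset_tupU _ hf), codiff_of_mem _ hf,
        d_truncTo_tupFlag _ hf]
    · simp [truncTo, codiff, hf]
  · refine ⟨mu, ⟨fun f hf => hmu.1 f fun h => hf (tupFlag_subset_tupU _ h), hmu.2⟩, ?_⟩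
    funext f
    by_cases hf : f ∈ TupFlag Y k
    · exact truncTo_of_mem _ hf
    · simp [truncTo, hf, hmu.1 f hf]
  · have halt : Alternating mu := hmu.2
    refine ⟨truncTo (TupU Y 0) (sd 0 mu), halt.sd.isAlt_truncTo fun _ => comp_perm_mem_tupU,
      codiff_truncTo_sd hS hU halt hd, ?_⟩
    funext f
    by_cases hf : f ∈ TupFlag Y 0
    · rw [truncTo_of_mem _ hf, truncTo_of_mem _ (tupFlag_subset_tupU _ hf), sd]
    · simp [truncTo, hf, hmu.1 f hf]
  · funext f
    by_cases hf : f ∈ TupU Y 0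
    · have hflag : f ∈ TupFlag Y 0 :=
        ⟨hf.1, Function.injective_of_subsingleton (α := Fin 1) f, fun i j =>
          Or.inl (by rw [Fin.fin_one_eq_zero i, Fin.fin_one_eq_zero j])⟩
      rw [← truncTo_of_mem lam hflag, h0]
    · exact hlam.1 f hf
  · have halt : Alternating mu := hmu.2
    have hdmu : ∀ f ∈ TupFlag Y (k + 2), d mu f = 0 :=
      fun f hf => d_eq_zero_of_codiff_eq_zero hd hf
    refine ⟨truncTo (TupU Y (k + 1)) (sd (k + 1) mu), truncTo (TupFlag Y k) (0 - htpy k mu),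
      halt.sd.isAlt_truncTo fun _ => comp_perm_mem_tupU, codiff_truncTo_sd hS hU halt hd,
      Alternating.isAlt_truncTo (fun _ => comp_perm_mem_tupFlag)
        (Alternating.sub (fun _ _ => by simp) halt.htpy), ?_⟩
    funext f
    by_cases hf : f ∈ TupFlag Y (k + 1)
    · have h := congrFun (d_htpy_add_htpy_d mu) f
      rw [Pi.add_apply, halt.d.htpy_eq_zero_of_flag hdmu hf, Pi.sub_apply] at h
      rw [truncTo_of_mem _ hf, truncTo_of_mem _ (tupFlag_subset_tupU _ hf), Pi.add_apply,
        codiff_of_mem _ hf, d_truncTo_tupFlag _ hf, d_sub, d_zero, Pi.sub_apply, Pi.zero_apply]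
      linear_combination h
    · simp [truncTo, codiff, hf, hmu.1 f hf]
  · rintro ⟨nu, hnu, heq⟩
    have hnu_alt : Alternating nu := hnu.2
    have halt : Alternating (lam - d nu) := Alternating.sub hlam.2 hnu_alt.d
    have hflag : ∀ f ∈ TupFlag Y (k + 1), (lam - d nu) f = 0 := fun f hf => by
      rw [Pi.sub_apply, ← truncTo_of_mem lam hf, heq, codiff_of_mem _ hf, sub_self]
    have hcocycle : ∀ f ∈ TupU Y (k + 2), d (lam - d nu) f = 0 := fun f hf => by
      rw [d_sub, d_d, sub_zero, d_eq_zero_of_codiff_eq_zero hd hf]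
    refine ⟨truncTo (TupU Y k) (nu + htpy k (lam - d nu)),
      (hnu_alt.add halt.htpy).isAlt_truncTo fun _ => comp_perm_mem_tupU, ?_⟩
    funext f
    by_cases hf : f ∈ TupU Y (k + 1)
    · have h := congrFun (d_htpy_add_htpy_d (lam - d nu)) f
      rw [Pi.add_apply, htpy_eq_zero_of_tupU hS hU hcocycle hf, Pi.sub_apply,
        halt.sd_eq_zero_of_flag hS hU hflag hf, Pi.sub_apply] at h
      rw [codiff_of_mem _ hf, d_truncTo_tupU hS hU _ hf, d_add, Pi.add_apply]
      linear_combination -h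
    · rw [hlam.1 f hf]
      exact (if_neg hf).symm
end

section
/- Let X be a simplicial complex on [n] and let Y ⊆ X be an arbitrary subset. Then |Y′| ⊆ ⟨Y⟩, and |Y′| is a deformation retract of ⟨Y⟩: there exists a continuous map H : ⟨Y⟩ × [0,1] → ⟨Y⟩ with H(α, 0) = α for all α ∈ ⟨Y⟩, H(α, 1) ∈ |Y′| for all α ∈ ⟨Y⟩, and H(α, t) = α for all α ∈ |Y′| and all t ∈ [0,1]. In particular ⟨Y⟩ and |Y′| are homotopy equivalent and have the same singular cohomology. -/
open scoped Classical

/-- Points of the realization of the cone `cone(X)` live in `ℝ^{[n] ∪ {c}}`, where the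
apex `c` of the cone is the extra vertex `none`. -/
abbrev ConePt (n : ℕ) := Option (Fin (n+1)) → ℝ

/-- The apex `δ_c` of the cone. -/
noncomputable def apexPt (n : ℕ) : ConePt n := fun v => if v = none then 1 else 0

/-- The support of a point, as a finite set of vertices. -/
noncomputable def ptSupp {n : ℕ} (α : ConePt n) : Finset (Option (Fin (n+1))) :=
  Finset.univ.filter (fun v => α v ≠ 0)

/-- The relatively open simplex `⟨f⟩` spanned by a nonempty face `f ⊆ [n]`:
barycentric coordinates in `[0,1]` summing to `1` with support exactly `f`
(viewed inside the cone, so the apex coordinate vanishes). -/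
def openCell {n : ℕ} (f : Finset (Fin (n+1))) : Set (ConePt n) :=
  {α | (∀ v, 0 ≤ α v ∧ α v ≤ 1) ∧ (∑ v, α v) = 1 ∧ ptSupp α = f.image some}

/-- `∪_{f ∈ Y, f ≠ ∅} ⟨f⟩`. -/
def baseUnion {n : ℕ} (Y : Set (Finset (Fin (n+1)))) : Set (ConePt n) :=
  ⋃ f ∈ {f | f ∈ Y ∧ f ≠ ∅}, openCell f

/-- `⟨Y⟩` for a subset `Y ⊆ X`: the union of the open cells of the nonempty faces
of `Y`, coned off over the apex `δ_c` when `∅ ∈ Y`. -/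
noncomputable def realSubset {n : ℕ} (Y : Set (Finset (Fin (n+1)))) : Set (ConePt n) :=
  if ∅ ∈ Y then
    {x | ∃ t ∈ Set.Icc (0:ℝ) 1, ∃ α ∈ baseUnion Y,
      x = t • apexPt n + (1 - t) • α} ∪ {apexPt n}
  else baseUnion Y

/-- The barycenter of a face `f` (the apex `δ_c` for `f = ∅`). -/
noncomputable def bary {n : ℕ} (f : Finset (Fin (n+1))) : ConePt n :=
  if f = ∅ then apexPt n
  else fun v => Option.elim v 0 (fun i => if i ∈ f then ((f.card : ℝ))⁻¹ else 0)

/-- `|Y′|`: the geometric realization of the order complex of `Y`, realized inside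
`|cone(X)|` as the union, over all flags (nonempty chains) in `Y`, of the convex
hulls of the barycenters of their members. -/
def orderReal {n : ℕ} (Y : Set (Finset (Fin (n+1)))) : Set (ConePt n) :=
  ⋃ C ∈ {C : Finset (Finset (Fin (n+1))) |
      ↑C ⊆ Y ∧ C.Nonempty ∧ IsChain (· ⊆ ·) (C : Set (Finset (Fin (n+1))))},
    convexHull ℝ (bary '' ↑C)

section BarycentricRetraction

variable {n : ℕ}

/-- The vertices of `[n]` in the support of a point of the cone. -/
noncomputable def baseSupp (x : ConePt n) : Finset (Fin (n+1)) :=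
  Finset.univ.filter (fun i => x (some i) ≠ 0)

theorem mem_baseSupp {x : ConePt n} {i : Fin (n+1)} : i ∈ baseSupp x ↔ x (some i) ≠ 0 := by
  simp [baseSupp]

theorem ptSupp_eq_image_some_iff {x : ConePt n} {f : Finset (Fin (n+1))} :
    ptSupp x = f.image some ↔ x none = 0 ∧ baseSupp x = f := by
  simp only [Finset.ext_iff, ptSupp, baseSupp, Option.forall]
  simp

theorem le_one_of_sum_eq_one {x : ConePt n} (h0 : ∀ v, 0 ≤ x v) (h1 : ∑ v, x v = 1)
    (v : Option (Fin (n+1))) : x v ≤ 1 :=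
  h1 ▸ Finset.single_le_sum (fun u _ => h0 u) (Finset.mem_univ v)

theorem mem_baseUnion_iff {Y : Set (Finset (Fin (n+1)))} {x : ConePt n} :
    x ∈ baseUnion Y ↔
      (∀ v, 0 ≤ x v) ∧ ∑ v, x v = 1 ∧ baseSupp x ∈ Y ∧ baseSupp x ≠ ∅ ∧ x none = 0 := by
  simp only [baseUnion, openCell, Set.mem_iUnion, Set.mem_ofPred_eq, ptSupp_eq_image_some_iff,
    exists_prop]
  constructor
  · rintro ⟨f, ⟨hf, hne⟩, h0, h1, hn, rfl⟩
    exact ⟨fun v => (h0 v).1, h1, hf, hne, hn⟩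
  · rintro ⟨h0, h1, hf, hne, hn⟩
    exact ⟨_, ⟨hf, hne⟩, fun v => ⟨h0 v, le_one_of_sum_eq_one h0 h1 v⟩, h1, hn, rfl⟩

theorem baseSupp_apexPt : baseSupp (apexPt n) = ∅ := by
  simp [baseSupp, apexPt]

theorem eq_apexPt_of_baseSupp_eq_empty {x : ConePt n} (h1 : ∑ v, x v = 1)
    (h : baseSupp x = ∅) : x = apexPt n := by
  have h0 : ∀ i, x (some i) = 0 := fun i => by
    by_contra hi
    simpa [h] using mem_baseSupp.2 hi
  rw [Fintype.sum_option] at h1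
  simp only [h0, Finset.sum_const_zero, add_zero] at h1
  ext v
  cases v <;> simp [apexPt, h0, h1]

theorem mem_realSubset_iff {Y : Set (Finset (Fin (n+1)))} {x : ConePt n} :
    x ∈ realSubset Y ↔
      (∀ v, 0 ≤ x v) ∧ ∑ v, x v = 1 ∧ baseSupp x ∈ Y ∧ (∅ ∉ Y → x none = 0) := by
  by_cases hY : ∅ ∈ Y
  · simp only [realSubset, hY, if_true, not_true, false_imp_iff, and_true]
    constructor
    · rintro (⟨t, ⟨ht0, ht1⟩, a, ha, rfl⟩ | rfl)
      · obtain ⟨h0, h1, hb, -, -⟩ := mem_baseUnion_iff.1 ha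
        refine ⟨fun v => ?_, ?_, ?_⟩
        · have : 0 ≤ apexPt n v := by unfold apexPt; split_ifs <;> norm_num
          have := h0 v
          have : 0 ≤ 1 - t := by linarith
          simp only [Pi.add_apply, Pi.smul_apply, smul_eq_mul]
          positivity
        · simp only [Pi.add_apply, Pi.smul_apply, smul_eq_mul, Finset.sum_add_distrib,
            ← Finset.mul_sum, h1]
          simp [apexPt]
        · rcases eq_or_ne t 1 with rfl | ht
          · simpa [baseSupp_apexPt] using hY
          · have : 1 - t ≠ 0 := sub_ne_zero.2 ht.symm
            convert hb using 1
            ext i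
            simp [mem_baseSupp, apexPt, this]
      · refine ⟨fun v => ?_, ?_, ?_⟩
        · unfold apexPt; split_ifs <;> norm_num
        · simp [apexPt]
        · rwa [baseSupp_apexPt]
    · rintro ⟨h0, h1, hb⟩
      by_cases he : baseSupp x = ∅
      · exact Or.inr (eq_apexPt_of_baseSupp_eq_empty h1 he)
      · left
        obtain ⟨i, hi⟩ := Finset.nonempty_iff_ne_empty.2 he
        have hipos : 0 < x (some i) := lt_of_le_of_ne (h0 _) (mem_baseSupp.1 hi).symm
        have h1' := h1
        rw [Fintype.sum_option] at h1'
        have hle : x (some i) ≤ ∑ j, x (some j) :=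
          Finset.single_le_sum (fun j _ => h0 (some j)) (Finset.mem_univ i)
        have hpos : 0 < 1 - x none := by linarith
        have hsum : ∑ j, x (some j) = 1 - x none := by linarith
        refine ⟨x none, ⟨h0 _, by linarith⟩,
          fun v => if v = none then 0 else (1 - x none)⁻¹ * x v, ?_, ?_⟩
        · have hbs : baseSupp (fun v => if v = none then 0 else (1 - x none)⁻¹ * x v)
              = baseSupp x := by
            ext j
            simp [mem_baseSupp, hpos.ne']
          rw [mem_baseUnion_iff, hbs]
          refine ⟨fun v => ?_, ?_, hb, he, by simp⟩
          · have := h0 v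
            split_ifs <;> positivity
          · simp [Fintype.sum_option, ← Finset.mul_sum, hsum, hpos.ne']
        · ext v
          cases v <;> simp [apexPt, hpos.ne']
  · simp only [realSubset, hY, if_false, not_false_iff, true_imp_iff, mem_baseUnion_iff]
    constructor
    · rintro ⟨h0, h1, hb, -, hn⟩
      exact ⟨h0, h1, hb, hn⟩
    · rintro ⟨h0, h1, hb, hn⟩
      exact ⟨h0, h1, hb, fun h => hY (h ▸ hb), hn⟩

theorem bary_some (f : Finset (Fin (n+1))) (i : Fin (n+1)) :
    bary f (some i) = if i ∈ f then (f.card : ℝ)⁻¹ else 0 := by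
  by_cases hf : f = ∅ <;> simp [bary, hf, apexPt]

theorem bary_none (f : Finset (Fin (n+1))) : bary f none = if f = ∅ then 1 else 0 := by
  by_cases hf : f = ∅ <;> simp [bary, hf, apexPt]

theorem bary_nonneg (f : Finset (Fin (n+1))) (v : Option (Fin (n+1))) : 0 ≤ bary f v := by
  cases v
  · rw [bary_none]; split_ifs <;> norm_num
  · rw [bary_some]; split_ifs <;> positivity

theorem bary_some_pos {f : Finset (Fin (n+1))} {i : Fin (n+1)} (hi : i ∈ f) :
    0 < bary f (some i) := by
  have : 0 < f.card := Finset.card_pos.2 ⟨i, hi⟩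
  rw [bary_some, if_pos hi]
  positivity

theorem sum_bary (f : Finset (Fin (n+1))) : ∑ v, bary f v = 1 := by
  rw [Fintype.sum_option, bary_none]
  simp only [bary_some]
  by_cases hf : f = ∅
  · simp [hf]
  · have : (f.card : ℝ) ≠ 0 := by simpa using hf
    simp [hf, this]

/-- The linear combination of barycenters with coefficients `w`. -/
noncomputable def baryComb (w : Finset (Fin (n+1)) → ℝ) : ConePt n := ∑ f, w f • bary f

theorem baryComb_apply (w : Finset (Fin (n+1)) → ℝ) (v : Option (Fin (n+1))) :
    baryComb w v = ∑ f, w f * bary f v := by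
  simp [baryComb]

theorem baryComb_none (w : Finset (Fin (n+1)) → ℝ) : baryComb w none = w ∅ := by
  simp [baryComb_apply, bary_none]

theorem sum_baryComb (w : Finset (Fin (n+1)) → ℝ) : ∑ v, baryComb w v = ∑ f, w f := by
  simp only [baryComb_apply]
  rw [Finset.sum_comm]
  simp only [← Finset.mul_sum, sum_bary, mul_one]

theorem baryComb_some_ne_zero_iff {w : Finset (Fin (n+1)) → ℝ} (h0 : ∀ f, 0 ≤ w f)
    (i : Fin (n+1)) : baryComb w (some i) ≠ 0 ↔ ∃ f, w f ≠ 0 ∧ i ∈ f := by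
  rw [baryComb_apply, Ne,
    Finset.sum_eq_zero_iff_of_nonneg fun f _ => mul_nonneg (h0 f) (bary_nonneg f _)]
  simp only [Finset.mem_univ, true_imp_iff, mul_eq_zero, not_forall, not_or]
  refine exists_congr fun f => and_congr_right fun _ => ⟨fun h => ?_, fun h => (bary_some_pos h).ne'⟩
  by_contra hi
  exact h (by rw [bary_some, if_neg hi])

/-- `w` is a system of barycentric coordinates on a flag of members of `Y`. -/
structure IsFlagWeight (Y : Set (Finset (Fin (n+1)))) (w : Finset (Fin (n+1)) → ℝ) : Prop where
  nonneg : ∀ f, 0 ≤ w f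
  sum_eq_one : ∑ f, w f = 1
  mem : ∀ f, w f ≠ 0 → f ∈ Y
  chain : ∀ f g, w f ≠ 0 → w g ≠ 0 → f ⊆ g ∨ g ⊆ f

theorem IsFlagWeight.baryComb_mem_orderReal {Y : Set (Finset (Fin (n+1)))}
    {w : Finset (Fin (n+1)) → ℝ} (hw : IsFlagWeight Y w) : baryComb w ∈ orderReal Y := by
  have hfilter : ∑ f with w f ≠ 0, w f = 1 := by
    rw [Finset.sum_filter_ne_zero, hw.sum_eq_one]
  refine Set.mem_biUnion (x := Finset.univ.filter fun f => w f ≠ 0) ⟨?_, ?_, ?_⟩ ?_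
  · intro f hf
    exact hw.mem f (by simpa using hf)
  · by_contra h
    rw [Finset.not_nonempty_iff_eq_empty.1 h] at hfilter
    simp at hfilter
  · intro f hf g hg _
    exact hw.chain f g (by simpa using hf) (by simpa using hg)
  · have : baryComb w = ∑ f with w f ≠ 0, w f • bary f := by
      rw [baryComb, Finset.sum_filter]
      refine Finset.sum_congr rfl fun f _ => ?_
      split_ifs with h
      · rfl
      · rw [not_not.1 h, zero_smul]
    rw [this]
    exact (convex_convexHull ℝ _).sum_mem (fun f _ => hw.nonneg f) hfilter
      fun f hf => subset_convexHull ℝ _ (Set.mem_image_of_mem _ hf)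

theorem exists_isFlagWeight_of_mem_orderReal {Y : Set (Finset (Fin (n+1)))} {x : ConePt n}
    (hx : x ∈ orderReal Y) : ∃ w, IsFlagWeight Y w ∧ x = baryComb w := by
  simp only [orderReal, Set.mem_iUnion, Set.mem_ofPred_eq] at hx
  obtain ⟨C, ⟨hCY, -, hC⟩, hx⟩ := hx
  have hsub : convexHull ℝ (bary '' (C : Set (Finset (Fin (n+1))))) ⊆
      {x | ∃ w : Finset (Fin (n+1)) → ℝ, (∀ f, 0 ≤ w f) ∧ ∑ f, w f = 1 ∧
        (∀ f, w f ≠ 0 → f ∈ C) ∧ x = baryComb w} := by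
    refine convexHull_min ?_ ?_
    · rintro _ ⟨f, hf, rfl⟩
      refine ⟨Pi.single f 1, fun g => ?_, by simp, fun g hg => ?_, ?_⟩
      · by_cases h : g = f
        · subst h; simp
        · simp [h]
      · by_contra h
        have hgf : g ≠ f := fun e => h (e ▸ hf)
        exact hg (Pi.single_eq_of_ne hgf 1)
      · ext v
        simp [baryComb_apply, Pi.single_apply]
    · rintro _ ⟨w, hw0, hw1, hwC, rfl⟩ _ ⟨u, hu0, hu1, huC, rfl⟩ a b ha hb hab
      refine ⟨fun f => a * w f + b * u f, fun f => ?_, ?_, fun f hf => ?_, ?_⟩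
      · have := hw0 f
        have := hu0 f
        positivity
      · rw [Finset.sum_add_distrib, ← Finset.mul_sum, ← Finset.mul_sum, hw1, hu1]
        linarith
      · by_contra h
        have h1 : w f = 0 := by_contra fun h' => h (hwC f h')
        have h2 : u f = 0 := by_contra fun h' => h (huC f h')
        simp [h1, h2] at hf
      · ext v
        simp only [Pi.add_apply, Pi.smul_apply, smul_eq_mul, baryComb_apply, Finset.mul_sum,
          ← Finset.sum_add_distrib]
        exact Finset.sum_congr rfl fun f _ => by ring
  obtain ⟨w, hw0, hw1, hwC, rfl⟩ := hsub hx
  exact ⟨w, ⟨hw0, hw1, fun f hf => hCY (hwC f hf),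
    fun f g hf hg => hC.total (hwC f hf) (hwC g hg)⟩, rfl⟩

theorem IsFlagWeight.baryComb_mem_realSubset {Y : Set (Finset (Fin (n+1)))}
    {w : Finset (Fin (n+1)) → ℝ} (hw : IsFlagWeight Y w) : baryComb w ∈ realSubset Y := by
  rw [mem_realSubset_iff]
  refine ⟨fun v => ?_, ?_, ?_, fun h => ?_⟩
  · rw [baryComb_apply]
    exact Finset.sum_nonneg fun f _ => mul_nonneg (hw.nonneg f) (bary_nonneg f v)
  · rw [sum_baryComb, hw.sum_eq_one]
  · have hne : (Finset.univ.filter fun f => w f ≠ 0).Nonempty := by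
      by_contra h
      have := hw.sum_eq_one
      rw [← Finset.sum_filter_ne_zero, Finset.not_nonempty_iff_eq_empty.1 h] at this
      simp at this
    obtain ⟨F, hF, hmax⟩ := Finset.exists_max_image _ Finset.card hne
    simp only [Finset.mem_filter, Finset.mem_univ, true_and] at hF hmax
    have : baseSupp (baryComb w) = F := by
      ext i
      rw [mem_baseSupp, baryComb_some_ne_zero_iff hw.nonneg]
      refine ⟨?_, fun hi => ⟨F, hF, hi⟩⟩
      rintro ⟨g, hg, hi⟩
      rcases hw.chain F g hF hg with h | h
      · rwa [Finset.eq_of_subset_of_card_le h (hmax g hg)]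
      · exact h hi
    rw [this]
    exact hw.mem F hF
  · rw [baryComb_none]
    by_contra h'
    exact h (hw.mem _ h')

/-- The least coordinate of `x` on `f` (`0` if `f` is empty). -/
noncomputable def minCoordOn (f : Finset (Fin (n+1))) (x : ConePt n) : ℝ :=
  if h : f.Nonempty then f.inf' h (fun i => x (some i)) else 0

/-- The largest coordinate of `x` off `f`; at least `0` as soon as `f` is nonempty. -/
noncomputable def maxCoordOff (f : Finset (Fin (n+1))) (x : ConePt n) : ℝ :=
  Finset.univ.sup' Finset.univ_nonempty (fun i => if i ∈ f then 0 else x (some i))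

theorem continuous_minCoordOn (f : Finset (Fin (n+1))) : Continuous (minCoordOn f) := by
  unfold minCoordOn
  split_ifs with h
  · exact Continuous.finset_inf'_apply h fun i _ => continuous_apply _
  · exact continuous_const

theorem continuous_maxCoordOff (f : Finset (Fin (n+1))) : Continuous (maxCoordOff f) := by
  refine Continuous.finset_sup'_apply _ fun i _ => ?_
  split_ifs
  · exact continuous_const
  · exact continuous_apply _

theorem lt_minCoordOn_iff {f : Finset (Fin (n+1))} (hf : f.Nonempty) {x : ConePt n} {s : ℝ} :
    s < minCoordOn f x ↔ ∀ i ∈ f, s < x (some i) := by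
  simp [minCoordOn, hf]

theorem maxCoordOff_le_iff {f : Finset (Fin (n+1))} (hf : f.Nonempty) {x : ConePt n} {s : ℝ} :
    maxCoordOff f x ≤ s ↔ 0 ≤ s ∧ ∀ i ∉ f, x (some i) ≤ s := by
  simp only [maxCoordOff, Finset.sup'_le_iff, Finset.mem_univ, true_imp_iff]
  constructor
  · intro h
    obtain ⟨i, hi⟩ := hf
    exact ⟨by simpa [hi] using h i, fun j hj => by simpa [hj] using h j⟩
  · rintro ⟨h0, h⟩ i
    split_ifs with hi
    · exact h0
    · exact h i hi

theorem mem_Ico_maxCoordOff_minCoordOn_iff {f : Finset (Fin (n+1))} (hf : f.Nonempty) {x : ConePt n}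
    {s : ℝ} :
    s ∈ Set.Ico (maxCoordOff f x) (minCoordOn f x) ↔ 0 ≤ s ∧ ∀ i, i ∈ f ↔ s < x (some i) := by
  rw [Set.mem_Ico, lt_minCoordOn_iff hf, maxCoordOff_le_iff hf, and_assoc]
  refine and_congr_right fun _ => ⟨fun ⟨h1, h2⟩ i => ⟨h2 i, fun h => ?_⟩,
    fun h => ⟨fun i hi => not_lt.1 fun h' => hi ((h i).2 h'), fun i hi => (h i).1 hi⟩⟩
  by_contra hi
  exact (h1 i hi).not_gt h

/-- The coordinate of `x` at the vertex `f` of the barycentric subdivision of the cone. -/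
noncomputable def subdivCoord (f : Finset (Fin (n+1))) (x : ConePt n) : ℝ :=
  if f = ∅ then x none else f.card * max (minCoordOn f x - maxCoordOff f x) 0

theorem continuous_subdivCoord (f : Finset (Fin (n+1))) : Continuous (subdivCoord f) := by
  unfold subdivCoord
  split_ifs
  · exact continuous_apply _
  · exact continuous_const.mul
      (((continuous_minCoordOn f).sub (continuous_maxCoordOff f)).max continuous_const)

theorem subdivCoord_nonneg (f : Finset (Fin (n+1))) {x : ConePt n} (hx : ∀ v, 0 ≤ x v) :
    0 ≤ subdivCoord f x := by
  unfold subdivCoord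
  split_ifs
  · exact hx _
  · positivity

theorem subdivCoord_ne_zero_iff {f : Finset (Fin (n+1))} (hf : f.Nonempty) {x : ConePt n} :
    subdivCoord f x ≠ 0 ↔ ∃ s : ℝ, 0 ≤ s ∧ ∀ i, i ∈ f ↔ s < x (some i) := by
  have : (f.card : ℝ) ≠ 0 := by simpa using hf.ne_empty
  simp only [← mem_Ico_maxCoordOff_minCoordOn_iff hf]
  rw [subdivCoord, if_neg hf.ne_empty, mul_ne_zero_iff, and_iff_right this, Ne, max_eq_right_iff,
    not_le, sub_pos, ← Set.nonempty_Ico]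
  rfl

theorem subdivCoord_chain {x : ConePt n} (f g : Finset (Fin (n+1))) (hf : subdivCoord f x ≠ 0)
    (hg : subdivCoord g x ≠ 0) : f ⊆ g ∨ g ⊆ f := by
  rcases f.eq_empty_or_nonempty with rfl | hfne
  · exact Or.inl (Finset.empty_subset _)
  rcases g.eq_empty_or_nonempty with rfl | hgne
  · exact Or.inr (Finset.empty_subset _)
  obtain ⟨s, -, hs⟩ := (subdivCoord_ne_zero_iff hfne).1 hf
  obtain ⟨t, -, ht⟩ := (subdivCoord_ne_zero_iff hgne).1 hg
  rcases le_total s t with h | h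
  · exact Or.inr fun i hi => (hs i).2 (h.trans_lt ((ht i).1 hi))
  · exact Or.inl fun i hi => (ht i).2 (h.trans_lt ((hs i).1 hi))

theorem subdivCoord_baseSupp_ne_zero {x : ConePt n} (hx : ∀ v, 0 ≤ x v) (h1 : ∑ v, x v = 1) :
    subdivCoord (baseSupp x) x ≠ 0 := by
  rcases (baseSupp x).eq_empty_or_nonempty with h | h
  · rw [h, eq_apexPt_of_baseSupp_eq_empty h1 h]
    simp [subdivCoord, apexPt]
  · rw [subdivCoord_ne_zero_iff h]
    exact ⟨0, le_rfl, fun i => by rw [mem_baseSupp, (hx _).lt_iff_ne']⟩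

theorem baryComb_subdivCoord {x : ConePt n} (hx : ∀ v, 0 ≤ x v) :
    baryComb (fun f => subdivCoord f x) = x := by
  ext v
  rcases v with _ | i
  · simp [baryComb_none, subdivCoord]
  have hvol : ∀ f : Finset (Fin (n+1)), subdivCoord f x * bary f (some i) =
      if i ∈ f then MeasureTheory.volume.real (Set.Ico (maxCoordOff f x) (minCoordOn f x)) else 0 := by
    intro f
    rw [bary_some]
    split_ifs with hi
    · have hf : f ≠ ∅ := Finset.ne_empty_of_mem hi
      have : (f.card : ℝ) ≠ 0 := by simpa using hf
      rw [subdivCoord, if_neg hf, Real.volume_real_Ico]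
      field_simp
    · rw [mul_zero]
  rw [baryComb_apply, Finset.sum_congr rfl fun f _ => hvol f, ← Finset.sum_filter,
    ← MeasureTheory.measureReal_biUnion_finset (h := fun f _ => measure_Ico_lt_top.ne)]
  · have : ⋃ f ∈ Finset.univ.filter (fun f : Finset (Fin (n+1)) => i ∈ f),
        Set.Ico (maxCoordOff f x) (minCoordOn f x) = Set.Ico 0 (x (some i)) := by
      ext s
      simp only [Set.mem_iUnion, Finset.mem_filter, Finset.mem_univ, true_and, exists_prop]
      constructor
      · rintro ⟨f, hi, hs⟩
        obtain ⟨h0, h⟩ := (mem_Ico_maxCoordOff_minCoordOn_iff ⟨i, hi⟩).1 hs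
        exact ⟨h0, (h i).1 hi⟩
      · rintro ⟨h0, h⟩
        have hi : i ∈ Finset.univ.filter (fun j => s < x (some j)) := by simpa using h
        exact ⟨_, hi, (mem_Ico_maxCoordOff_minCoordOn_iff ⟨i, hi⟩).2 ⟨h0, fun j => by simp⟩⟩
    rw [this, Real.volume_real_Ico, sub_zero, max_eq_left (hx _)]
  · intro f hf g hg hfg
    simp only [Finset.coe_filter, Finset.mem_univ, true_and, Set.mem_ofPred_eq] at hf hg
    refine Set.disjoint_left.2 fun s hsf hsg => hfg ?_
    ext j
    rw [((mem_Ico_maxCoordOff_minCoordOn_iff ⟨i, hf⟩).1 hsf).2,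
      ((mem_Ico_maxCoordOff_minCoordOn_iff ⟨i, hg⟩).1 hsg).2]
  · exact fun f _ => measurableSet_Ico

/-- Superlevel sets of a point on a flag belong to the flag. -/
theorem IsFlagWeight.mem_of_subdivCoord_ne_zero {Y : Set (Finset (Fin (n+1)))}
    {w : Finset (Fin (n+1)) → ℝ} (hw : IsFlagWeight Y w) {f : Finset (Fin (n+1))}
    (hf : subdivCoord f (baryComb w) ≠ 0) : f ∈ Y := by
  rcases f.eq_empty_or_nonempty with rfl | hne
  · exact hw.mem _ (by simpa [subdivCoord, baryComb_none] using hf)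
  obtain ⟨s, hs0, hs⟩ := (subdivCoord_ne_zero_iff hne).1 hf
  obtain ⟨i, hi, hmin⟩ := Finset.exists_min_image f (fun i => baryComb w (some i)) hne
  have hU : (Finset.univ.filter fun g => w g ≠ 0 ∧ i ∈ g).Nonempty := by
    obtain ⟨g, hg⟩ := (baryComb_some_ne_zero_iff hw.nonneg i).1 (hs0.trans_lt ((hs i).1 hi)).ne'
    exact ⟨g, by simpa using hg⟩
  obtain ⟨g, hg, hgmin⟩ := Finset.exists_min_image _ Finset.card hU
  simp only [Finset.mem_filter, Finset.mem_univ, true_and] at hg hgmin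
  obtain ⟨hwg, hig⟩ := hg
  have hle : ∀ h, w h ≠ 0 → i ∈ h → g ⊆ h := fun h hwh hih => by
    rcases hw.chain g h hwg hwh with hgh | hgh
    · exact hgh
    · exact (Finset.eq_of_subset_of_card_le hgh (hgmin h ⟨hwh, hih⟩)).ge
  suffices f = g from this ▸ hw.mem g hwg
  apply Finset.Subset.antisymm
  · intro j hj
    by_contra hjg
    refine (hmin j hj).not_gt ?_
    rw [baryComb_apply, baryComb_apply]
    refine Finset.sum_lt_sum (fun h _ => ?_) ⟨g, Finset.mem_univ g, ?_⟩
    · rcases eq_or_ne (w h) 0 with hwh | hwh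
      · simp [hwh]
      by_cases hjh : j ∈ h
      · have hih : i ∈ h := by
          rcases hw.chain g h hwg hwh with hgh | hgh
          · exact hgh hig
          · exact absurd (hgh hjh) hjg
        simp [bary_some, hjh, hih]
      · rw [bary_some, if_neg hjh, mul_zero]
        exact mul_nonneg (hw.nonneg h) (bary_nonneg h _)
    · rw [bary_some, if_neg hjg, mul_zero]
      exact mul_pos ((hw.nonneg g).lt_of_ne' hwg) (bary_some_pos hig)
  · intro j hj
    refine (hs j).2 (((hs i).1 hi).trans_le ?_)
    rw [baryComb_apply, baryComb_apply]
    refine Finset.sum_le_sum fun h _ => ?_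
    rcases eq_or_ne (w h) 0 with hwh | hwh
    · simp [hwh]
    by_cases hih : i ∈ h
    · simp [bary_some, hih, hle h hwh hih hj]
    · rw [bary_some, if_neg hih, mul_zero]
      exact mul_nonneg (hw.nonneg h) (bary_nonneg h _)

/-- The subdivision coordinates of `x` at the members of `Y`. -/
noncomputable def restrictedCoord (Y : Set (Finset (Fin (n+1)))) (x : ConePt n)
    (f : Finset (Fin (n+1))) : ℝ :=
  if f ∈ Y then subdivCoord f x else 0

theorem restrictedCoord_ne_zero_iff {Y : Set (Finset (Fin (n+1)))} {x : ConePt n}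
    {f : Finset (Fin (n+1))} : restrictedCoord Y x f ≠ 0 ↔ f ∈ Y ∧ subdivCoord f x ≠ 0 := by
  simp [restrictedCoord]

theorem restrictedCoord_nonneg (Y : Set (Finset (Fin (n+1)))) {x : ConePt n} (hx : ∀ v, 0 ≤ x v)
    (f : Finset (Fin (n+1))) : 0 ≤ restrictedCoord Y x f := by
  unfold restrictedCoord
  split_ifs
  · exact subdivCoord_nonneg f hx
  · exact le_rfl

theorem continuous_restrictedCoord (Y : Set (Finset (Fin (n+1)))) (f : Finset (Fin (n+1))) :
    Continuous fun x => restrictedCoord Y x f := by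
  unfold restrictedCoord
  split_ifs
  · exact continuous_subdivCoord f
  · exact continuous_const

theorem sum_restrictedCoord_pos {Y : Set (Finset (Fin (n+1)))} {x : ConePt n}
    (hx : x ∈ realSubset Y) : 0 < ∑ f, restrictedCoord Y x f := by
  obtain ⟨h0, h1, hb, -⟩ := mem_realSubset_iff.1 hx
  have hne := restrictedCoord_ne_zero_iff.2 ⟨hb, subdivCoord_baseSupp_ne_zero h0 h1⟩
  exact Finset.sum_pos' (fun f _ => restrictedCoord_nonneg Y h0 f)
    ⟨_, Finset.mem_univ _, (restrictedCoord_nonneg Y h0 _).lt_of_ne' hne⟩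

/-- The barycentric coordinates of the retraction of `⟨Y⟩` onto `|Y′|`. -/
noncomputable def retractWeight (Y : Set (Finset (Fin (n+1)))) (x : ConePt n)
    (f : Finset (Fin (n+1))) : ℝ :=
  (∑ g, restrictedCoord Y x g)⁻¹ * restrictedCoord Y x f

theorem retractWeight_ne_zero_iff {Y : Set (Finset (Fin (n+1)))} {x : ConePt n}
    (hx : x ∈ realSubset Y) {f : Finset (Fin (n+1))} :
    retractWeight Y x f ≠ 0 ↔ f ∈ Y ∧ subdivCoord f x ≠ 0 := by
  rw [retractWeight, mul_ne_zero_iff, restrictedCoord_ne_zero_iff,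
    and_iff_right (inv_ne_zero (sum_restrictedCoord_pos hx).ne')]

theorem isFlagWeight_retractWeight {Y : Set (Finset (Fin (n+1)))} {x : ConePt n}
    (hx : x ∈ realSubset Y) : IsFlagWeight Y (retractWeight Y x) where
  nonneg f := mul_nonneg (inv_nonneg.2 (sum_restrictedCoord_pos hx).le)
    (restrictedCoord_nonneg Y (mem_realSubset_iff.1 hx).1 f)
  sum_eq_one := by
    simp only [retractWeight]
    rw [← Finset.mul_sum, inv_mul_cancel₀ (sum_restrictedCoord_pos hx).ne']
  mem f hf := ((retractWeight_ne_zero_iff hx).1 hf).1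
  chain f g hf hg := subdivCoord_chain f g ((retractWeight_ne_zero_iff hx).1 hf).2
    ((retractWeight_ne_zero_iff hx).1 hg).2

theorem baseSupp_baryComb_retractWeight {Y : Set (Finset (Fin (n+1)))} {x : ConePt n}
    (hx : x ∈ realSubset Y) : baseSupp (baryComb (retractWeight Y x)) = baseSupp x := by
  obtain ⟨h0, h1, hb, -⟩ := mem_realSubset_iff.1 hx
  ext i
  rw [mem_baseSupp, baryComb_some_ne_zero_iff (isFlagWeight_retractWeight hx).nonneg]
  constructor
  · rintro ⟨f, hf, hi⟩
    obtain ⟨s, hs0, hs⟩ :=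
      (subdivCoord_ne_zero_iff ⟨i, hi⟩).1 ((retractWeight_ne_zero_iff hx).1 hf).2
    exact mem_baseSupp.2 (hs0.trans_lt ((hs i).1 hi)).ne'
  · intro hi
    exact ⟨_, (retractWeight_ne_zero_iff hx).2 ⟨hb, subdivCoord_baseSupp_ne_zero h0 h1⟩, hi⟩

theorem orderReal_subset_realSubset (Y : Set (Finset (Fin (n+1)))) :
    orderReal Y ⊆ realSubset Y := by
  intro x hx
  obtain ⟨w, hw, rfl⟩ := exists_isFlagWeight_of_mem_orderReal hx
  exact hw.baryComb_mem_realSubset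

theorem baryComb_retractWeight_of_mem_orderReal {Y : Set (Finset (Fin (n+1)))} {x : ConePt n}
    (hx : x ∈ orderReal Y) : baryComb (retractWeight Y x) = x := by
  obtain ⟨h0, h1, -, -⟩ := mem_realSubset_iff.1 (orderReal_subset_realSubset Y hx)
  have hcoord : restrictedCoord Y x = fun f => subdivCoord f x := by
    obtain ⟨w, hw, rfl⟩ := exists_isFlagWeight_of_mem_orderReal hx
    ext f
    unfold restrictedCoord
    split_ifs with hf
    · rfl
    · by_contra h
      exact hf (hw.mem_of_subdivCoord_ne_zero (Ne.symm h))
  have hcomb := baryComb_subdivCoord h0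
  have hsum : ∑ f, subdivCoord f x = 1 := by
    rw [← h1, ← sum_baryComb, hcomb]
  have : retractWeight Y x = fun f => subdivCoord f x := by
    ext f
    rw [retractWeight, hcoord, hsum, inv_one, one_mul]
  rw [this, hcomb]

theorem continuousOn_baryComb_retractWeight (Y : Set (Finset (Fin (n+1)))) :
    ContinuousOn (fun x => baryComb (retractWeight Y x)) (realSubset Y) := by
  refine continuousOn_finsetSum _ fun f _ => ?_
  suffices ContinuousOn (fun x => retractWeight Y x f) (realSubset Y) by fun_prop
  exact ((continuous_finsetSum _ fun g _ => continuous_restrictedCoord Y g).continuousOn.inv₀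
    fun x hx => (sum_restrictedCoord_pos hx).ne').mul (continuous_restrictedCoord Y f).continuousOn

theorem lineMap_baryComb_retractWeight_mem {Y : Set (Finset (Fin (n+1)))} {x : ConePt n}
    (hx : x ∈ realSubset Y) {t : ℝ} (ht : t ∈ Set.Icc (0:ℝ) 1) :
    (1 - t) • x + t • baryComb (retractWeight Y x) ∈ realSubset Y := by
  have hb := baseSupp_baryComb_retractWeight hx
  have hr := (isFlagWeight_retractWeight hx).baryComb_mem_realSubset
  set y := baryComb (retractWeight Y x)
  rw [mem_realSubset_iff] at hx hr ⊢
  obtain ⟨hx0, hx1, hxY, hxn⟩ := hx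
  obtain ⟨hy0, hy1, -, hyn⟩ := hr
  have ht0 : 0 ≤ t := ht.1
  have ht1 : 0 ≤ 1 - t := sub_nonneg.2 ht.2
  simp only [Pi.add_apply, Pi.smul_apply, smul_eq_mul]
  refine ⟨fun v => add_nonneg (mul_nonneg ht1 (hx0 v)) (mul_nonneg ht0 (hy0 v)), ?_, ?_,
    fun h => by rw [hxn h, hyn h]; ring⟩
  · rw [Finset.sum_add_distrib, ← Finset.mul_sum, ← Finset.mul_sum, hx1, hy1]
    ring
  · convert hxY using 1
    ext i
    have hxy : y (some i) ≠ 0 ↔ x (some i) ≠ 0 := by rw [← mem_baseSupp, hb, mem_baseSupp]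
    simp only [mem_baseSupp, Pi.add_apply, Pi.smul_apply, smul_eq_mul]
    refine ⟨fun h hxi => h ?_, fun hxi => ?_⟩
    · rw [hxi, not_not.1 (mt hxy.1 (not_not.2 hxi))]
      ring
    · have hxp := (hx0 _).lt_of_ne' hxi
      have hyp := (hy0 _).lt_of_ne' (hxy.2 hxi)
      rcases ht0.eq_or_lt with rfl | htp
      · simpa using hxi
      · positivity

end BarycentricRetraction

/-- for an arbitrary subset `Y ⊆ X`, `|Y′| ⊆ ⟨Y⟩` and `|Y′|` is a
deformation retract of `⟨Y⟩`: there is a continuous `H : ⟨Y⟩ × [0,1] → ⟨Y⟩` with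
`H(α,0) = α`, `H(α,1) ∈ |Y′|`, and `H(α,t) = α` for `α ∈ |Y′|`. -/
theorem orderComplex_deformation_retract {n : ℕ} (S : Set (Finset (Fin (n+1))))
    (hS : IsSimplicialComplex S) (Y : Set (Finset (Fin (n+1)))) (hY : Y ⊆ S) :
    orderReal Y ⊆ realSubset Y ∧
    ∃ H : ConePt n × ℝ → ConePt n,
      ContinuousOn H (realSubset Y ×ˢ Set.Icc (0:ℝ) 1) ∧
      (∀ α ∈ realSubset Y, ∀ t ∈ Set.Icc (0:ℝ) 1, H (α, t) ∈ realSubset Y) ∧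
      (∀ α ∈ realSubset Y, H (α, 0) = α) ∧
      (∀ α ∈ realSubset Y, H (α, 1) ∈ orderReal Y) ∧
      (∀ α ∈ orderReal Y, ∀ t ∈ Set.Icc (0:ℝ) 1, H (α, t) = α) := by
  refine ⟨orderReal_subset_realSubset Y,
    fun p => (1 - p.2) • p.1 + p.2 • baryComb (retractWeight Y p.1), ?_, ?_, ?_, ?_, ?_⟩
  · have hr : ContinuousOn (fun p : ConePt n × ℝ => baryComb (retractWeight Y p.1))
        (realSubset Y ×ˢ Set.Icc (0:ℝ) 1) :=
      (continuousOn_baryComb_retractWeight Y).comp continuousOn_fst fun p hp => hp.1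
    fun_prop
  · exact fun α hα t ht => lineMap_baryComb_retractWeight_mem hα ht
  · intro α _
    simp
  · intro α hα
    simpa using (isFlagWeight_retractWeight hα).baryComb_mem_orderReal
  · intro α hα t _
    simp only [baryComb_retractWeight_of_mem_orderReal hα, ← add_smul, sub_add_cancel, one_smul]
end

section
/- Let X be a simplicial complex on [n] and b ⊆ [n] nonempty. (1) If some proper subset of b is not a face of X, then U_b = Ũ_b = X. (2) If every proper subset of b is a face of X, then: X ∖ U_b = ∅ when b ∉ X, and X ∖ U_b = st̄(b,X) when b ∈ X; furthermore X ∖ Ũ_b = ∂b ∗ L_b when b ∉ X, and X ∖ Ũ_b = (∂b ∗ L_b) ∪ st̄(b,X) when b ∈ X. -/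
/-- The closed star `st̄(f,X) = {g ∈ X : g ∪ f ∈ X}`. -/
def closedStar {n : ℕ} (S : Set (Finset (Fin (n+1)))) (f : Finset (Fin (n+1))) :
    Set (Finset (Fin (n+1))) :=
  {g | g ∈ S ∧ g ∪ f ∈ S}

/-- `link(f,X) = {g ∈ X : g ∩ f = ∅ and g ∪ f ∈ X}`. -/
def link {n : ℕ} (S : Set (Finset (Fin (n+1)))) (f : Finset (Fin (n+1))) :
    Set (Finset (Fin (n+1))) :=
  {g | g ∈ S ∧ g ∩ f = ∅ ∧ g ∪ f ∈ S}

/-- `U_b = {f ∈ X : f ∪ b ∉ X}`. -/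
def Ub {n : ℕ} (S : Set (Finset (Fin (n+1)))) (b : Finset (Fin (n+1))) :
    Set (Finset (Fin (n+1))) :=
  {f | f ∈ S ∧ f ∪ b ∉ S}

/-- `Ũ_b = {f ∈ X : (f ∪ b) ∖ {v} ∉ X for some v ∈ b}`. -/
def Utb {n : ℕ} (S : Set (Finset (Fin (n+1)))) (b : Finset (Fin (n+1))) :
    Set (Finset (Fin (n+1))) :=
  {f | f ∈ S ∧ ∃ v ∈ b, (f ∪ b) \ {v} ∉ S}

/-- `L_b = ∩_{b′ ⊊ b} link(b′, X)`. -/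
def Lb {n : ℕ} (S : Set (Finset (Fin (n+1)))) (b : Finset (Fin (n+1))) :
    Set (Finset (Fin (n+1))) :=
  ⋂ b' ∈ {b' : Finset (Fin (n+1)) | b' ⊂ b}, link S b'

/-- The join `∂b ∗ L_b = {b′ ∪ g : b′ ⊊ b, g ∈ L_b}`. -/
def joinBdryLb {n : ℕ} (S : Set (Finset (Fin (n+1)))) (b : Finset (Fin (n+1))) :
    Set (Finset (Fin (n+1))) :=
  {h | ∃ b' ⊂ b, ∃ g ∈ Lb S b, h = b' ∪ g}

section SimplicialComplex

variable {n : ℕ} {S : Set (Finset (Fin (n+1)))} {b f : Finset (Fin (n+1))}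

theorem mem_diff_Ub : f ∈ S \ Ub S b ↔ f ∈ closedStar S b := by
  simp only [Ub, closedStar, Set.mem_sdiff, Set.mem_ofPred_eq]
  tauto

theorem mem_diff_Utb : f ∈ S \ Utb S b ↔ f ∈ S ∧ ∀ v ∈ b, (f ∪ b) \ {v} ∈ S := by
  simp only [Utb, Set.mem_sdiff, Set.mem_ofPred_eq, not_and, not_exists, not_not]
  tauto

theorem mem_Lb {g : Finset (Fin (n+1))} :
    g ∈ Lb S b ↔ ∀ b' ⊂ b, g ∈ S ∧ g ∩ b' = ∅ ∧ g ∪ b' ∈ S := by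
  simp only [Lb, link, Set.mem_iInter, Set.mem_ofPred_eq]

theorem closedStar_eq_empty (hS : IsSimplicialComplex S) (hb : b ∉ S) :
    closedStar S b = ∅ :=
  Set.eq_empty_of_forall_notMem fun _ hf =>
    hb (hS.2 _ hf.2 _ Finset.subset_union_right)

theorem closedStar_subset_diff_Utb (hS : IsSimplicialComplex S) :
    closedStar S b ⊆ S \ Utb S b := fun _ hf =>
  mem_diff_Utb.2 ⟨hf.1, fun _ _ => hS.2 _ hf.2 _ Finset.sdiff_subset⟩

theorem joinBdryLb_subset_diff_Utb (hS : IsSimplicialComplex S) :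
    joinBdryLb S b ⊆ S \ Utb S b := by
  rintro _ ⟨b', hb', g, hg, rfl⟩
  rw [mem_Lb] at hg
  refine mem_diff_Utb.2 ⟨Finset.union_comm g b' ▸ (hg b' hb').2.2, fun v hv => ?_⟩
  refine hS.2 _ (hg (b.erase v) (Finset.erase_ssubset hv)).2.2 _ fun x hx => ?_
  have := @hb'.1 x
  simp only [Finset.mem_sdiff, Finset.mem_union, Finset.mem_singleton,
    Finset.mem_erase] at hx ⊢
  tauto

theorem mem_joinBdryLb_of_not_subset (hS : IsSimplicialComplex S)
    (hf : f ∈ S \ Utb S b) (hbf : ¬ b ⊆ f) : f ∈ joinBdryLb S b := by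
  rw [mem_diff_Utb] at hf
  refine ⟨b ∩ f, ⟨Finset.inter_subset_left, fun h => hbf fun x hx =>
    (Finset.mem_inter.1 (h hx)).2⟩, f \ b, mem_Lb.2 fun b' hb' => ⟨?_, ?_, ?_⟩, ?_⟩
  · exact hS.2 f hf.1 _ Finset.sdiff_subset
  · exact Finset.disjoint_iff_inter_eq_empty.1
      (Finset.sdiff_disjoint.mono_right hb'.1)
  · obtain ⟨v, hv, hvb'⟩ := Finset.exists_of_ssubset hb'
    refine hS.2 _ (hf.2 v hv) _ fun x hx => ?_
    have := @hb'.1 x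
    simp only [Finset.mem_sdiff, Finset.mem_union, Finset.mem_singleton] at hx ⊢
    grind
  · ext x
    simp only [Finset.mem_union, Finset.mem_inter, Finset.mem_sdiff]
    tauto

theorem diff_Utb_eq (hS : IsSimplicialComplex S) :
    S \ Utb S b = joinBdryLb S b ∪ closedStar S b := by
  refine Set.Subset.antisymm (fun f hf => ?_)
    (Set.union_subset (joinBdryLb_subset_diff_Utb hS) (closedStar_subset_diff_Utb hS))
  by_cases hbf : b ⊆ f
  · exact Or.inr ⟨hf.1, (Finset.union_eq_left.2 hbf).symm ▸ hf.1⟩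
  · exact Or.inl (mem_joinBdryLb_of_not_subset hS hf hbf)

theorem Ub_eq_and_Utb_eq_of_notMem (hS : IsSimplicialComplex S)
    {b' : Finset (Fin (n+1))} (hb' : b' ⊂ b) (hb'S : b' ∉ S) :
    Ub S b = S ∧ Utb S b = S := by
  constructor
  · exact Set.Subset.antisymm (fun _ h => h.1) fun f hf =>
      ⟨hf, fun h => hb'S (hS.2 _ h _ (hb'.1.trans Finset.subset_union_right))⟩
  · obtain ⟨v, hv, hvb'⟩ := Finset.exists_of_ssubset hb'
    refine Set.Subset.antisymm (fun _ h => h.1) fun f hf =>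
      ⟨hf, v, hv, fun h => hb'S (hS.2 _ h _ fun x hx => ?_)⟩
    rw [Finset.mem_sdiff, Finset.mem_singleton]
    exact ⟨Finset.mem_union_right _ (hb'.1 hx), fun hxv => hvb' (hxv ▸ hx)⟩

end SimplicialComplex

/-- (1) if some proper subset of `b` is not a face, then
`U_b = Ũ_b = X`; (2) if every proper subset of `b` is a face, then `X ∖ U_b` is `∅`
resp. `st̄(b,X)` according to whether `b` is a non-face or a face, and `X ∖ Ũ_b` is
`∂b ∗ L_b` resp. `(∂b ∗ L_b) ∪ st̄(b,X)`. -/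
theorem complement_of_Ub_Utb {n : ℕ} (S : Set (Finset (Fin (n+1))))
    (hS : IsSimplicialComplex S) (b : Finset (Fin (n+1))) (hb : b ≠ ∅) :
    ((∃ b' ⊂ b, b' ∉ S) → Ub S b = S ∧ Utb S b = S) ∧
    ((∀ b' ⊂ b, b' ∈ S) →
      (b ∉ S → S \ Ub S b = ∅ ∧ S \ Utb S b = joinBdryLb S b) ∧
      (b ∈ S → S \ Ub S b = closedStar S b ∧
        S \ Utb S b = joinBdryLb S b ∪ closedStar S b)) := by
  refine ⟨fun ⟨b', hb', hb'S⟩ => Ub_eq_and_Utb_eq_of_notMem hS hb' hb'S,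
    fun _ => ⟨fun hbS => ?_, fun _ => ⟨Set.ext fun _ => mem_diff_Ub, diff_Utb_eq hS⟩⟩⟩
  have hstar := closedStar_eq_empty hS hbS
  exact ⟨(Set.ext fun _ => mem_diff_Ub).trans hstar,
    by rw [diff_Utb_eq hS, hstar, Set.union_empty]⟩
end

section
/- Let X be a simplicial complex on [n] (with ∅ ∈ X), let v ∈ [n], and let 𝐚 ∈ ℕ^{n+1} whose support a is a face of X. Then the ℂ-linear derivation x^𝐚 · ∂/∂x_v of P = ℂ[x_0,…,x_n] maps the Stanley–Reisner ideal I_X into I_X if and only if st̄(a,X) ⊆ st̄(v,X). -/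
open MvPolynomial

/-- The squarefree monomial `x^p = ∏_{i ∈ p} x_i`. -/
noncomputable def xmon {n : ℕ} (p : Finset (Fin (n+1))) : MvPolynomial (Fin (n+1)) ℂ :=
  ∏ i ∈ p, X i

/-- The monomial `x^e` for an exponent vector `e ∈ ℕ^{n+1}`. -/
noncomputable def emon {n : ℕ} (e : Fin (n+1) → ℕ) : MvPolynomial (Fin (n+1)) ℂ :=
  monomial (Finsupp.equivFunOnFinite.symm e) 1

/-- The Stanley–Reisner ideal `I_X = (x^p : p ∉ X)`. -/
noncomputable def SRideal {n : ℕ} (S : Set (Finset (Fin (n+1)))) :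
    Ideal (MvPolynomial (Fin (n+1)) ℂ) :=
  Ideal.span {q | ∃ p : Finset (Fin (n+1)), p ∉ S ∧ q = xmon p}

/-- The support of `𝐚 ∈ ℕ^{n+1}`. -/
def suppV {n : ℕ} (A : Fin (n+1) → ℕ) : Finset (Fin (n+1)) :=
  Finset.univ.filter (fun i => A i ≠ 0)

theorem emon_eq_prod {n : ℕ} (A : Fin (n+1) → ℕ) :
    emon A = ∏ i, (X i : MvPolynomial (Fin (n+1)) ℂ) ^ A i := by
  rw [emon, monomial_eq, Finsupp.prod_fintype _ _ (fun i => pow_zero _)]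
  simp

theorem xmon_mem_SRideal {n : ℕ} {S : Set (Finset (Fin (n+1)))} {p : Finset (Fin (n+1))}
    (hp : p ∉ S) : xmon p ∈ SRideal S :=
  Ideal.subset_span ⟨p, hp, rfl⟩

theorem xmon_suppV_dvd_emon {n : ℕ} (A : Fin (n+1) → ℕ) : xmon (suppV A) ∣ emon A := by
  rw [emon_eq_prod]
  refine (Finset.prod_dvd_prod_of_dvd _ _ fun i hi => ?_).trans
    (Finset.prod_dvd_prod_of_subset _ _ _ (Finset.subset_univ (suppV A)))
  exact dvd_pow_self _ (Finset.mem_filter.mp hi).2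

theorem xmon_union_dvd {n : ℕ} (p : Finset (Fin (n+1))) (A : Fin (n+1) → ℕ) :
    xmon (p ∪ suppV A) ∣ emon A * xmon p := by
  have h : xmon (p ∪ suppV A) = xmon (suppV A \ p) * xmon p := by
    rw [xmon, xmon, xmon, ← Finset.union_sdiff_self_eq_union,
      Finset.prod_union Finset.disjoint_sdiff, mul_comm]
  rw [h]
  exact mul_dvd_mul_right
    ((Finset.prod_dvd_prod_of_subset _ _ _ Finset.sdiff_subset).trans (xmon_suppV_dvd_emon A)) _

theorem pderiv_xmon_of_notMem {n : ℕ} {v : Fin (n+1)} {p : Finset (Fin (n+1))} (hv : v ∉ p) :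
    pderiv v (xmon p) = 0 := by
  induction p using Finset.induction_on with
  | empty => simp [xmon]
  | insert i p hi ih =>
    simp only [Finset.mem_insert, not_or] at hv
    have h : xmon (insert i p) = X i * xmon p := Finset.prod_insert hi
    rw [h, Derivation.leibniz, ih hv.2, pderiv_X_of_ne (Ne.symm hv.1)]
    simp

theorem pderiv_xmon_insert {n : ℕ} {v : Fin (n+1)} {p : Finset (Fin (n+1))} (hv : v ∉ p) :
    pderiv v (xmon (insert v p)) = xmon p := by
  have h : xmon (insert v p) = X v * xmon p := Finset.prod_insert hv
  rw [h, Derivation.leibniz, pderiv_xmon_of_notMem hv, pderiv_X_self]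
  simp

/-- The Stanley–Reisner ideal vanishes at the indicator vector of every face. -/
theorem eval_indicator_eq_zero {n : ℕ} {S : Set (Finset (Fin (n+1)))}
    (hS : IsSimplicialComplex S) {f : Finset (Fin (n+1))} (hf : f ∈ S)
    {q : MvPolynomial (Fin (n+1)) ℂ} (hq : q ∈ SRideal S) :
    eval (fun i => if i ∈ f then (1 : ℂ) else 0) q = 0 := by
  have hle : SRideal S ≤ RingHom.ker (eval (fun i => if i ∈ f then (1 : ℂ) else 0)) := by
    refine Ideal.span_le.mpr ?_
    rintro _ ⟨p, hp, rfl⟩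
    obtain ⟨i, hip, hif⟩ := Finset.not_subset.mp fun h => hp (hS.2 f hf p h)
    rw [SetLike.mem_coe, RingHom.mem_ker, xmon, map_prod]
    exact Finset.prod_eq_zero hip (by simp [hif])
  exact hle hq

theorem eval_indicator_emon_mul_xmon {n : ℕ} (A : Fin (n+1) → ℕ) (p : Finset (Fin (n+1))) :
    eval (fun i => if i ∈ p ∪ suppV A then (1 : ℂ) else 0) (emon A * xmon p) = 1 := by
  rw [map_mul, emon_eq_prod, xmon, map_prod, map_prod, Finset.prod_eq_one, Finset.prod_eq_one,
    one_mul]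
  · intro i hi
    simp [hi]
  · intro i _
    by_cases h : A i = 0 <;> simp [h, suppV]

/-- the derivation `x^𝐚 · ∂/∂x_v` of `P = ℂ[x_0,…,x_n]` maps `I_X` into
`I_X` if and only if `st̄(a,X) ⊆ st̄(v,X)`, where `a` is the support of `𝐚`. -/
theorem derivation_preserves_ideal_iff {n : ℕ} (S : Set (Finset (Fin (n+1))))
    (hS : IsSimplicialComplex S) (v : Fin (n+1)) (A : Fin (n+1) → ℕ)
    (hA : suppV A ∈ S) :
    (∀ q ∈ SRideal S, emon A * MvPolynomial.pderiv v q ∈ SRideal S) ↔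
      closedStar S (suppV A) ⊆ closedStar S {v} := by
  constructor
  · rintro h g ⟨hg, hga⟩
    refine ⟨hg, ?_⟩
    by_contra hgv
    have hv : v ∉ g := fun hv =>
      hgv (by rwa [Finset.union_eq_left.mpr (Finset.singleton_subset_iff.mpr hv)])
    rw [Finset.union_comm, ← Finset.insert_eq] at hgv
    have hmem := h _ (xmon_mem_SRideal hgv)
    rw [pderiv_xmon_insert hv] at hmem
    have h0 := eval_indicator_eq_zero hS hga hmem
    rw [eval_indicator_emon_mul_xmon] at h0
    exact one_ne_zero h0
  · intro h q hq
    refine Submodule.span_induction ?_ ?_ ?_ ?_ hq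
    · rintro _ ⟨p, hp, rfl⟩
      by_cases hv : v ∈ p
      · rw [← Finset.insert_erase hv, pderiv_xmon_insert (Finset.notMem_erase v p)]
        refine Ideal.mem_of_dvd _ (xmon_union_dvd _ A) (xmon_mem_SRideal fun hmem => hp ?_)
        have := (h ⟨hS.2 _ hmem _ Finset.subset_union_left, hmem⟩).2
        rwa [Finset.union_comm, ← Finset.insert_eq, Finset.insert_erase hv] at this
      · rw [pderiv_xmon_of_notMem hv, mul_zero]
        exact zero_mem _
    · simp
    · intro x y _ _ hx hy
      rw [map_add, mul_add]
      exact add_mem hx hy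
    · intro r x hx hdx
      rw [smul_eq_mul, Derivation.leibniz, smul_eq_mul, smul_eq_mul, mul_add, mul_left_comm,
        ← mul_assoc (emon A)]
      exact add_mem (Ideal.mul_mem_left _ _ hdx)
        (Ideal.mul_mem_right _ _ (Ideal.mul_mem_left _ _ hx))
end

section
/- Let X be a simplicial complex on [n]. The following are equivalent: (1) there exist no face a ∈ X and vertex v of X (i.e., {v} ∈ X) with v ∉ a and st̄(a,X) ⊆ st̄(v,X); (2) every face of X that is not maximal with respect to inclusion is properly contained in at least two distinct faces of X. -/
/-- If `a` is properly contained in exactly one face, then some vertex outside `a` dominates `a`. -/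
theorem exists_dominating_vertex_of_unique {n : ℕ} {S : Set (Finset (Fin (n+1)))}
    (hS : IsSimplicialComplex S) {a f : Finset (Fin (n+1))} (hf : f ∈ S) (haf : a ⊂ f)
    (huniq : ∀ g ∈ S, a ⊂ g → g = f) :
    ∃ v : Fin (n+1), {v} ∈ S ∧ v ∉ a ∧ closedStar S a ⊆ closedStar S {v} := by
  obtain ⟨v, hvf, hva⟩ := Finset.exists_of_ssubset haf
  refine ⟨v, hS.2 f hf _ (Finset.singleton_subset_iff.2 hvf), hva, fun g hg => ⟨hg.1, ?_⟩⟩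
  have hgf : g ⊆ f := by
    rcases (Finset.subset_union_right : a ⊆ g ∪ a).eq_or_ssubset with h | h
    · exact (Finset.union_eq_right.1 h.symm).trans haf.subset
    · exact huniq _ hg.2 h ▸ Finset.subset_union_left
  exact hS.2 f hf _ (Finset.union_subset hgf (Finset.singleton_subset_iff.2 hvf))

/-- If `v` dominates `a`, a largest face containing `a` and avoiding `v` is properly contained
in exactly one face. -/
theorem exists_unique_ssuperset_of_dominating_vertex {n : ℕ} {S : Set (Finset (Fin (n+1)))}
    (hS : IsSimplicialComplex S) {a : Finset (Fin (n+1))} (ha : a ∈ S) {v : Fin (n+1)}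
    (hva : v ∉ a) (hdom : closedStar S a ⊆ closedStar S {v}) :
    ∃ b ∈ S, ∃ f ∈ S, b ⊂ f ∧ ∀ g ∈ S, b ⊂ g → g = f := by
  obtain ⟨b, hab, hb⟩ := (Set.toFinite {b | b ∈ S ∧ a ⊆ b ∧ v ∉ b}).exists_le_maximal
    (show a ∈ {b | b ∈ S ∧ a ⊆ b ∧ v ∉ b} from ⟨ha, subset_rfl, hva⟩)
  obtain ⟨hbS, -, hvb⟩ := hb.prop
  have hbv : b ∪ {v} ∈ S := (hdom ⟨hbS, by rwa [Finset.union_eq_left.2 hab]⟩).2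
  refine ⟨b, hbS, b ∪ {v}, hbv, ?_, fun g hg hbg => ?_⟩
  · exact Finset.ssubset_iff_of_subset Finset.subset_union_left |>.2 ⟨v, by simp, hvb⟩
  · have hvg : v ∈ g := by
      by_contra hvg
      exact hbg.not_subset (hb.le_of_ge ⟨hg, hab.trans hbg.subset, hvg⟩ hbg.subset)
    have hle : b ⊆ g.erase v := Finset.subset_erase.2 ⟨hbg.subset, hvb⟩
    have hge : g.erase v ⊆ b :=
      hb.le_of_ge ⟨hS.2 g hg _ (Finset.erase_subset _ _), hab.trans hle,
        Finset.notMem_erase v g⟩ hle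
    rw [hle.antisymm hge, Finset.union_comm, ← Finset.insert_eq, Finset.insert_erase hvg]

/-- there are no face `a ∈ X` and vertex `v` of `X` with `v ∉ a` and
`st̄(a,X) ⊆ st̄(v,X)` if and only if every non-maximal face of `X` is properly
contained in at least two distinct faces of `X`. -/
theorem no_dominating_vertex_iff {n : ℕ} (S : Set (Finset (Fin (n+1))))
    (hS : IsSimplicialComplex S) :
    (¬ ∃ a ∈ S, ∃ v : Fin (n+1), {v} ∈ S ∧ v ∉ a ∧
        closedStar S a ⊆ closedStar S {v}) ↔
    (∀ a ∈ S, (∃ f ∈ S, a ⊂ f) →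
      ∃ f ∈ S, ∃ g ∈ S, a ⊂ f ∧ a ⊂ g ∧ f ≠ g) := by
  constructor
  · rintro h a ha ⟨f, hf, haf⟩
    by_contra hne
    refine h ⟨a, ha, exists_dominating_vertex_of_unique hS hf haf fun g hg hag => ?_⟩
    by_contra hgf
    exact hne ⟨g, hg, f, hf, hag, haf, hgf⟩
  · rintro h ⟨a, ha, v, -, hva, hdom⟩
    obtain ⟨b, hb, f, hf, hbf, huniq⟩ :=
      exists_unique_ssuperset_of_dominating_vertex hS ha hva hdom
    obtain ⟨g, hg, g', hg', hbg, hbg', hne⟩ := h b hb ⟨f, hf, hbf⟩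
    exact hne ((huniq g hg hbg).trans (huniq g' hg' hbg').symm)
end

section
/- Let X be a simplicial complex on [n], let v be a vertex of X (i.e., {v} ∈ X), and let a, b ⊆ [n] be disjoint. Set a₀ = a ∖ {v} and b₀ = b ∖ {v}. Then the map ψ(g) = g ∪ ({v} ∖ b) maps N_{a₀−b₀}(link(v,X)) into N_{a−b}(X), and it maps Ñ_{a₀−b₀}(link(v,X)) into Ñ_{a−b}(X). -/
def Nab {n : ℕ} (S : Set (Finset (Fin (n+1)))) (a b : Finset (Fin (n+1))) :
    Set (Finset (Fin (n+1))) :=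
  {f | f ∈ S ∧ a ⊆ f ∧ f ∩ b = ∅ ∧ f ∪ b ∉ S}

def Ntilde {n : ℕ} (S : Set (Finset (Fin (n+1)))) (a b : Finset (Fin (n+1))) :
    Set (Finset (Fin (n+1))) :=
  {f | f ∈ Nab S a b ∧ ∃ b' ⊂ b, f ∪ b' ∉ S}

/-- `link(v,X) = {g ∈ X : v ∉ g and g ∪ {v} ∈ X}` for a vertex `v`. -/
def linkV {n : ℕ} (S : Set (Finset (Fin (n+1)))) (v : Fin (n+1)) :
    Set (Finset (Fin (n+1))) :=
  {g | g ∈ S ∧ v ∉ g ∧ g ∪ {v} ∈ S}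

/-- Enlarging a face `g` of the link of `v` by vertices other than `v` leaves the link only if
the corresponding enlargement of `g ∪ {v}` leaves the complex. -/
lemma union_union_singleton_notMem_of_notMem_linkV {n : ℕ} {S : Set (Finset (Fin (n+1)))}
    (hS : IsSimplicialComplex S) {v : Fin (n+1)} {g c : Finset (Fin (n+1))}
    (hg : v ∉ g) (hc : v ∉ c) (h : g ∪ c ∉ linkV S v) : g ∪ c ∪ {v} ∉ S := fun hmem =>
  h ⟨hS.2 _ hmem _ Finset.subset_union_left, by simp [hg, hc], hmem⟩

lemma union_sdiff_mem_Nab_of_mem_Nab_linkV {n : ℕ} {S : Set (Finset (Fin (n+1)))}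
    (hS : IsSimplicialComplex S) {v : Fin (n+1)} {a b g : Finset (Fin (n+1))}
    (hab : Disjoint a b) (hg : g ∈ Nab (linkV S v) (a \ {v}) (b \ {v})) :
    g ∪ ({v} \ b) ∈ Nab S a b := by
  obtain ⟨⟨_, hvg, hgv⟩, hag, hgb, hN⟩ := hg
  refine ⟨hS.2 _ hgv _ (Finset.union_subset_union_right Finset.sdiff_subset), ?_, ?_, ?_⟩
  · intro x hx
    have hxb := Finset.disjoint_left.mp hab hx
    have := @hag x
    grind
  · rw [← Finset.disjoint_iff_inter_eq_empty, Finset.disjoint_left] at hgb ⊢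
    intro x hx hxb
    have := @hgb x
    grind
  · have h := union_union_singleton_notMem_of_notMem_linkV hS hvg (by simp) hN
    have heq : g ∪ ({v} \ b) ∪ b = g ∪ (b \ {v}) ∪ {v} := by grind
    rwa [heq]

lemma union_sdiff_mem_Ntilde_of_mem_Ntilde_linkV {n : ℕ} {S : Set (Finset (Fin (n+1)))}
    (hS : IsSimplicialComplex S) {v : Fin (n+1)} {a b g : Finset (Fin (n+1))}
    (hab : Disjoint a b) (hg : g ∈ Ntilde (linkV S v) (a \ {v}) (b \ {v})) :
    g ∪ ({v} \ b) ∈ Ntilde S a b := by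
  obtain ⟨hN, c, hcb, hc⟩ := hg
  have hvc : v ∉ c := fun hv => by simpa using hcb.subset hv
  refine ⟨union_sdiff_mem_Nab_of_mem_Nab_linkV hS hab hN, c ∪ ({v} ∩ b), ?_, ?_⟩
  · obtain ⟨x, hxb, hxc⟩ := Finset.exists_of_ssubset hcb
    refine (Finset.ssubset_iff_of_subset ?_).mpr ⟨x, ?_, ?_⟩
    · exact Finset.union_subset (hcb.subset.trans Finset.sdiff_subset) Finset.inter_subset_right
    · grind
    · grind
  · have h := union_union_singleton_notMem_of_notMem_linkV hS hN.1.2.1 hvc hc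
    have heq : g ∪ ({v} \ b) ∪ (c ∪ ({v} ∩ b)) = g ∪ c ∪ {v} := by grind
    rwa [heq]

/-- with `a₀ = a ∖ {v}` and `b₀ = b ∖ {v}`, the map
`ψ(g) = g ∪ ({v} ∖ b)` maps `N_{a₀−b₀}(link(v,X))` into `N_{a−b}(X)` and
`Ñ_{a₀−b₀}(link(v,X))` into `Ñ_{a−b}(X)`. -/
theorem localization_map_on_N {n : ℕ} (S : Set (Finset (Fin (n+1))))
    (hS : IsSimplicialComplex S) (v : Fin (n+1)) (hv : {v} ∈ S)
    (a b : Finset (Fin (n+1))) (hab : Disjoint a b) :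
    (∀ g ∈ Nab (linkV S v) (a \ {v}) (b \ {v}),
      g ∪ ({v} \ b) ∈ Nab S a b) ∧
    (∀ g ∈ Ntilde (linkV S v) (a \ {v}) (b \ {v}),
      g ∪ ({v} \ b) ∈ Ntilde S a b) := by
  exact ⟨fun _ hg => union_sdiff_mem_Nab_of_mem_Nab_linkV hS hab hg,
    fun _ hg => union_sdiff_mem_Ntilde_of_mem_Ntilde_linkV hS hab hg⟩
end
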